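/- arXiv:2202.11894 — 3 statements merged into one kernel-verified Lean document; each statement's English description precedes it below -/
import Mathlib

section
/- Let (g,⟨·,·⟩) be a metric Lie algebra with dim g = 3, and let X ∈ g be a stationary point of the Euler equation. Then X is stable if and only if one of the following holds: (i) J_X = 0, or (ii) σ₂(J_X) ≥ 0 and σ₁(J_X) ≤ 0, with at least one of these two inequalities strict. -/
open scoped InnerProductSpace

/-- A Lie algebra structure (a bilinear Lie bracket) on the real inner product space `g`,
making `(g, ⟨·,·⟩)` a metric Lie algebra. -/
structure LieStructure (g : Type*) [NormedAddCommGroup g] [InnerProductSpace ℝ g] where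
  bracket : g →ₗ[ℝ] g →ₗ[ℝ] g
  bracket_self : ∀ x, bracket x x = 0
  jacobi : ∀ x y z, bracket x (bracket y z) + bracket y (bracket z x) + bracket z (bracket x y) = 0

namespace LieStructure

variable {g : Type*} [NormedAddCommGroup g] [InnerProductSpace ℝ g] [FiniteDimensional ℝ g]
variable (L : LieStructure g)

/-- `ad_Y : Z ↦ [Y, Z]`. -/
def ad (Y : g) : g →ₗ[ℝ] g := L.bracket Y

/-- `ad_Yᵗ`, the adjoint of `ad_Y` with respect to the inner product. -/
noncomputable def adT (Y : g) : g →ₗ[ℝ] g := LinearMap.adjoint (L.ad Y)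

/-- A solution of the Euler equation `Ẏ = ad_Yᵗ Y`. -/
def IsSolution (Y : ℝ → g) : Prop := ∀ t : ℝ, HasDerivAt Y (L.adT (Y t) (Y t)) t

/-- A stationary point (equilibrium) of the Euler equation: `ad_Xᵗ X = 0`. -/
def IsStationary (X : g) : Prop := L.adT X X = 0

/-- Lyapunov stability of a point `X` for the Euler equation: every solution starting
close to `X` remains close to `X` for all `t ≥ 0`. -/
def IsStable (X : g) : Prop :=
  ∀ ε > 0, ∃ δ > 0, ∀ Y : ℝ → g, L.IsSolution Y → ‖Y 0 - X‖ < δ → ∀ t ≥ 0, ‖Y t - X‖ < ε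

/-- The linearisation `J_X : Y ↦ ad_Xᵗ Y + ad_Yᵗ X` of the Euler equation at `X`. -/
noncomputable def J (X : g) : g →ₗ[ℝ] g where
  toFun Y := L.adT X Y + L.adT Y X
  map_add' Y Z := by
    simp only [adT, ad, map_add, LinearMap.add_apply]
    abel
  map_smul' c Y := by
    simp only [adT, ad, map_smul, map_smulₛₗ, starRingEnd_apply, star_trivial,
      LinearMap.smul_apply, RingHom.id_apply, smul_add]

/-- `g` is unimodular: `Tr (ad_X) = 0` for all `X`. -/
def IsUnimodular : Prop := ∀ X : g, LinearMap.trace ℝ g (L.ad X) = 0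

/-- The centre of `g`: the set of `X` with `[X, ·] = 0`. -/
def center : Submodule ℝ g := LinearMap.ker L.bracket

end LieStructure

/-- `σ_k(J)`: the `k`-th elementary symmetric function of the eigenvalues of `J`, i.e.
`(-1)^k` times the coefficient of `λ^(n-k)` in the characteristic polynomial
`det (λ·id - J)` of `J`, where `n = dim g`. -/
noncomputable def sigmaCoeff {g : Type*} [NormedAddCommGroup g] [InnerProductSpace ℝ g]
    [FiniteDimensional ℝ g] (k : ℕ) (J : g →ₗ[ℝ] g) : ℝ :=
  (-1 : ℝ) ^ k * (LinearMap.charpoly J).coeff (Module.finrank ℝ g - k)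

section GlobalFlow

open Set Metric Filter Topology

/-- A bounded, globally Lipschitz vector field has a global integral curve through each point. -/
theorem exists_forall_hasDerivAt_of_lipschitzWith_of_bounded {E : Type*} [NormedAddCommGroup E]
    [NormedSpace ℝ E] [CompleteSpace E] {f : E → E} {K C : NNReal} (hf : LipschitzWith K f)
    (hC : ∀ x, ‖f x‖ ≤ C) (x₀ : E) :
    ∃ α : ℝ → E, α 0 = x₀ ∧ ∀ t, HasDerivAt α (f (α t)) t := by
  have hloc : ∀ T : NNReal, ∃ α : ℝ → E, α 0 = x₀ ∧
      ∀ t ∈ Ioo (-(T : ℝ)) T, HasDerivAt α (f (α t)) t := by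
    intro T
    have hP : IsPicardLindelof (fun _ ↦ f) (tmin := -(T : ℝ)) (tmax := T)
        ⟨0, by simp⟩ x₀ (C * T) 0 C K :=
      IsPicardLindelof.of_time_independent (fun x _ ↦ hC x) hf.lipschitzOnWith (by simp)
    obtain ⟨α, h0, hα⟩ := hP.exists_eq_forall_mem_Icc_hasDerivWithinAt₀
    exact ⟨α, h0, fun t ht ↦ (hα t (Ioo_subset_Icc_self ht)).hasDerivAt (Icc_mem_nhds ht.1 ht.2)⟩
  choose γ hγ0 hγ using hloc
  have huniq : ∀ S T : NNReal, 0 < S → S ≤ T → EqOn (γ S) (γ T) (Ioo (-(S : ℝ)) S) := by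
    intro S T hS hST
    have hST' : (S : ℝ) ≤ T := hST
    refine ODE_solution_unique_of_mem_Ioo (v := fun _ ↦ f) (s := fun _ ↦ univ) (K := K) (t₀ := 0)
      (fun _ _ ↦ hf.lipschitzOnWith) (by simpa using hS)
      (fun t ht ↦ ⟨hγ S t ht, trivial⟩)
      (fun t ht ↦ ⟨hγ T t ⟨by linarith [ht.1], by linarith [ht.2]⟩, trivial⟩)
      (by rw [hγ0, hγ0])
  refine ⟨fun t ↦ γ (‖t‖₊ + 1) t, hγ0 _, fun t ↦ ?_⟩
  have hev : (fun s ↦ γ (‖s‖₊ + 1) s) =ᶠ[𝓝 t] γ (‖t‖₊ + 2) := by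
    have hnear : ∀ᶠ s in 𝓝 t, ‖s‖₊ < ‖t‖₊ + 1 :=
      (continuous_nnnorm.tendsto t).eventually (gt_mem_nhds (by simp))
    filter_upwards [hnear] with s hs
    refine huniq _ _ (by positivity) ?_ ?_
    · calc ‖s‖₊ + 1 ≤ ‖t‖₊ + 1 + 1 := by gcongr
        _ = ‖t‖₊ + 2 := by rw [add_assoc]; norm_num
    · have h := abs_lt.1 (lt_add_one |s|)
      simpa using h
  have hmem : t ∈ Ioo (-((‖t‖₊ + 2 : NNReal) : ℝ)) ((‖t‖₊ + 2 : NNReal) : ℝ) := by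
    have h := abs_lt.1 (show |t| < |t| + 2 by linarith)
    simpa using h
  have := (hγ _ t hmem).congr_of_eventuallyEq hev
  rwa [← hev.eq_of_nhds] at this

end GlobalFlow

namespace LieStructure

variable {g : Type*} [NormedAddCommGroup g] [InnerProductSpace ℝ g] [FiniteDimensional ℝ g]
variable (L : LieStructure g)

theorem inner_adT_left (Y Z W : g) : ⟪L.adT Y Z, W⟫_ℝ = ⟪Z, L.bracket Y W⟫_ℝ := by
  rw [adT, LinearMap.adjoint_inner_left, ad]

theorem contDiff_adT_self : ContDiff ℝ 1 fun Y : g ↦ L.adT Y Y := by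
  let B := stdOrthonormalBasis ℝ g
  have h : (fun Y : g ↦ L.adT Y Y) =
      fun Y ↦ ∑ i, ⟪Y, LinearMap.toContinuousLinearMap (L.bracket.flip (B i)) Y⟫_ℝ • B i := by
    funext Y
    rw [← B.sum_repr (L.adT Y Y)]
    refine Finset.sum_congr rfl fun i _ ↦ ?_
    rw [B.repr_apply_apply, real_inner_comm, inner_adT_left]
    rfl
  rw [h]
  exact ContDiff.sum fun i _ ↦
    (contDiff_id.inner ℝ (ContinuousLinearMap.contDiff _)).smul contDiff_const

theorem norm_eq_of_hasDerivAt_smul_adT {Y : ℝ → g} {c : ℝ → ℝ}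
    (hY : ∀ t, HasDerivAt Y (c t • L.adT (Y t) (Y t)) t) (t : ℝ) : ‖Y t‖ = ‖Y 0‖ := by
  have hd : ∀ s, HasDerivAt (fun s ↦ ‖Y s‖ ^ 2) 0 s := by
    intro s
    have h := (hY s).norm_sq
    rwa [real_inner_smul_right, real_inner_comm, inner_adT_left, L.bracket_self, inner_zero_right,
      mul_zero, mul_zero] at h
  have h := is_const_of_deriv_eq_zero (fun s ↦ (hd s).differentiableAt) (fun s ↦ (hd s).deriv) t 0
  exact (sq_eq_sq₀ (norm_nonneg _) (norm_nonneg _)).1 h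

theorem IsSolution.norm_eq {L : LieStructure g} {Y : ℝ → g} (hY : L.IsSolution Y) (t : ℝ) :
    ‖Y t‖ = ‖Y 0‖ :=
  L.norm_eq_of_hasDerivAt_smul_adT (c := fun _ ↦ 1) (fun s ↦ by simpa using hY s) t

/-- The Euler equation has a global solution for every initial value. -/
theorem exists_isSolution (y : g) : ∃ Y : ℝ → g, L.IsSolution Y ∧ Y 0 = y := by
  let φ : ContDiffBump (0 : g) := ⟨‖y‖ + 1, ‖y‖ + 2, by positivity, by linarith⟩
  let f : g → g := fun Y ↦ φ Y • L.adT Y Y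
  have hf : ContDiff ℝ 1 f := φ.contDiff.smul L.contDiff_adT_self
  have hs : HasCompactSupport f := φ.hasCompactSupport.smul_right
  obtain ⟨K, hK⟩ := hf.lipschitzWith_of_hasCompactSupport hs one_ne_zero
  obtain ⟨C, hC⟩ := hs.exists_bound_of_continuous hf.continuous
  obtain ⟨Y, hY0, hY⟩ := exists_forall_hasDerivAt_of_lipschitzWith_of_bounded hK
    (C := C.toNNReal) (fun x ↦ (hC x).trans (Real.le_coe_toNNReal C)) y
  refine ⟨Y, fun t ↦ ?_, hY0⟩
  have hn := L.norm_eq_of_hasDerivAt_smul_adT hY t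
  have h1 : φ (Y t) = 1 := φ.one_of_mem_closedBall (by
    rw [mem_closedBall_zero_iff, hn, hY0]
    exact le_add_of_nonneg_right zero_le_one)
  have h := hY t
  simp only [f, h1, one_smul] at h
  exact h

end LieStructure

section Lyapunov

open Set Metric Filter Topology

/-- Lyapunov's stability criterion for a family of continuous curves in a proper metric space: a
function which is positive on a punctured closed ball, vanishes at the centre and does not exceed
its initial value along a curve as long as the curve stays in the ball. -/
theorem exists_forall_dist_lt_of_lyapunov {E : Type*} [MetricSpace E] [ProperSpace E]
    {S : Set (ℝ → E)} (hS : ∀ Y ∈ S, Continuous Y) {x₀ : E} {r : ℝ} (hr : 0 < r) {V : E → ℝ}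
    (hV : ContinuousOn V (closedBall x₀ r)) (hV0 : V x₀ = 0)
    (hpos : ∀ y ∈ closedBall x₀ r, y ≠ x₀ → 0 < V y)
    (hmono : ∀ Y ∈ S, ∀ t ≥ 0, (∀ s ∈ Icc 0 t, Y s ∈ closedBall x₀ r) → V (Y t) ≤ V (Y 0)) :
    ∀ ε > 0, ∃ δ > 0, ∀ Y ∈ S, dist (Y 0) x₀ < δ → ∀ t ≥ 0, dist (Y t) x₀ < ε := by
  intro ε hε
  obtain ⟨η, hη, hηε, hηr⟩ : ∃ η > 0, η ≤ ε ∧ η ≤ r :=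
    ⟨min ε r, lt_min hε hr, min_le_left _ _, min_le_right _ _⟩
  have hsub : sphere x₀ η ⊆ closedBall x₀ r :=
    sphere_subset_closedBall.trans (closedBall_subset_closedBall hηr)
  obtain ⟨m, hm, hmV⟩ : ∃ m > 0, ∀ y ∈ sphere x₀ η, m ≤ V y := by
    rcases (sphere x₀ η).eq_empty_or_nonempty with h | h
    · exact ⟨1, one_pos, by simp [h]⟩
    · obtain ⟨y, hy, hmin⟩ := (isCompact_sphere x₀ η).exists_isMinOn h (hV.mono hsub)
      refine ⟨V y, hpos y (hsub hy) ?_, fun z hz ↦ hmin hz⟩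
      rintro rfl
      simp [hη.ne] at hy
  have hcont : ContinuousAt V x₀ := hV.continuousAt (closedBall_mem_nhds x₀ hr)
  obtain ⟨δ, hδ, hδV⟩ := Metric.mem_nhds_iff.1
    (hcont.eventually (gt_mem_nhds (show V x₀ < m by rwa [hV0])))
  refine ⟨min δ η, lt_min hδ hη, fun Y hY h0 ↦ ?_⟩
  have hstart : V (Y 0) < m := hδV (mem_ball.2 (h0.trans_le (min_le_left _ _)))
  suffices h : ∀ t ≥ 0, dist (Y t) x₀ < η from fun t ht ↦ (h t ht).trans_le hηε
  intro t ht
  by_contra! hcon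
  have hd : Continuous fun s ↦ dist (Y s) x₀ := (hS Y hY).dist continuous_const
  let T : Set ℝ := {s | s ∈ Icc 0 t ∧ η ≤ dist (Y s) x₀}
  have hTc : IsCompact T :=
    isCompact_Icc.inter_right (isClosed_le continuous_const hd)
  obtain ⟨s, ⟨⟨hs0, hst⟩, hsη⟩, hmin⟩ := hTc.exists_isLeast ⟨t, ⟨ht, le_rfl⟩, hcon⟩
  have hbefore : ∀ s' ∈ Ico 0 s, dist (Y s') x₀ < η := by
    intro s' hs'
    by_contra! h
    exact absurd (hmin ⟨⟨hs'.1, hs'.2.le.trans hst⟩, h⟩) (not_le.2 hs'.2)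
  have hspos : 0 < s := by
    refine hs0.lt_of_ne ?_
    rintro rfl
    exact absurd (h0.trans_le (min_le_right _ _)) (not_lt.2 hsη)
  have hseq : dist (Y s) x₀ = η := by
    refine le_antisymm ?_ hsη
    have hcl : s ∈ closure (Ico 0 s) := by
      rw [closure_Ico hspos.ne]
      exact ⟨hs0, le_rfl⟩
    exact closure_minimal (fun s' hs' ↦ (hbefore s' hs').le)
      (isClosed_le hd continuous_const) hcl
  have hle := hmono Y hY s hs0 fun s' hs' ↦ by
    rcases hs'.2.lt_or_eq with h | h
    · exact mem_closedBall.2 ((hbefore s' ⟨hs'.1, h⟩).le.trans hηr)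
    · exact mem_closedBall.2 (by rw [h, hseq]; exact hηr)
  exact absurd (hmV (Y s) hseq) (not_le.2 (hle.trans_lt hstart))

theorem le_of_hasDerivAt_nonpos {φ φ' : ℝ → ℝ} {t : ℝ} (ht : 0 ≤ t)
    (hφ : ∀ s ∈ Icc 0 t, HasDerivAt φ (φ' s) s) (h : ∀ s ∈ Icc 0 t, φ' s ≤ 0) : φ t ≤ φ 0 := by
  refine antitoneOn_of_hasDerivWithinAt_nonpos (convex_Icc 0 t) (f' := φ')
    (fun s hs ↦ (hφ s hs).continuousAt.continuousWithinAt)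
    (fun s hs ↦ (hφ s (interior_subset hs)).hasDerivWithinAt)
    (fun s hs ↦ h s (interior_subset hs)) ⟨le_rfl, ht⟩ ⟨ht, le_rfl⟩ ht

theorem le_of_hasDerivAt_nonneg {φ φ' : ℝ → ℝ} (hφ : ∀ s, HasDerivAt φ (φ' s) s)
    (h : ∀ s ≥ 0, 0 ≤ φ' s) {t : ℝ} (ht : 0 ≤ t) : φ 0 ≤ φ t := by
  have := le_of_hasDerivAt_nonpos (φ := fun s ↦ -φ s) (φ' := fun s ↦ -φ' s) ht
    (fun s _ ↦ (hφ s).neg) (fun s hs ↦ neg_nonpos.2 (h s hs.1))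
  linarith

theorem false_of_le_deriv_of_bounded {φ φ' : ℝ → ℝ} {c M : ℝ} (hc : 0 < c)
    (hφ : ∀ s, HasDerivAt φ (φ' s) s) (h : ∀ s ≥ 0, c ≤ φ' s) (hM : ∀ s ≥ 0, φ s ≤ M) : False := by
  have hgrow : ∀ t ≥ 0, φ 0 ≤ φ t - c * t := by
    intro t ht
    have := le_of_hasDerivAt_nonneg (φ := fun s ↦ φ s - c * s) (φ' := fun s ↦ φ' s - c * 1)
      (fun s ↦ (hφ s).sub ((hasDerivAt_id s).const_mul c)) (fun s hs ↦ by linarith [h s hs]) ht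
    simpa using this
  have hM0 : 0 ≤ M - φ 0 := by linarith [hM 0 le_rfl]
  have hT : (0 : ℝ) ≤ (M - φ 0 + 1) / c := by positivity
  have h1 := hgrow _ hT
  have h2 := hM _ hT
  rw [mul_div_cancel₀ _ hc.ne'] at h1
  linarith

theorem false_of_mul_le_deriv_of_bounded {φ φ' : ℝ → ℝ} {c M : ℝ} (hc : 0 < c)
    (hφ : ∀ s, HasDerivAt φ (φ' s) s) (h : ∀ s ≥ 0, c * φ s ≤ φ' s) (h0 : 0 < φ 0)
    (hM : ∀ s ≥ 0, φ s ≤ M) : False := by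
  have hexp : ∀ s, HasDerivAt (fun s ↦ Real.exp (-(c * s))) (Real.exp (-(c * s)) * -(c * 1)) s :=
    fun s ↦ ((hasDerivAt_id s).const_mul c).neg.exp
  have hge : ∀ t ≥ 0, φ 0 ≤ φ t := by
    intro t ht
    have := le_of_hasDerivAt_nonneg (fun s ↦ (hφ s).mul (hexp s)) (fun s hs ↦ by
      have := mul_nonneg (sub_nonneg.2 (h s hs)) (Real.exp_pos (-(c * s))).le
      linarith) ht
    have hle : Real.exp (-(c * t)) ≤ 1 := Real.exp_le_one_iff.2 (by nlinarith)
    simp only [Pi.mul_apply, mul_zero, neg_zero, Real.exp_zero, mul_one] at this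
    have hpos : 0 < φ t := pos_of_mul_pos_left (h0.trans_le this) (Real.exp_pos _).le
    nlinarith
  exact false_of_le_deriv_of_bounded (mul_pos hc h0) hφ
    (fun s hs ↦ (mul_le_mul_of_nonneg_left (hge s hs) hc.le).trans (h s hs)) hM

theorem pos_of_hasDerivAt_mul_self {φ k : ℝ → ℝ} (hk : Continuous k)
    (hφ : ∀ s, HasDerivAt φ (k s * φ s) s) (h0 : 0 < φ 0) (t : ℝ) : 0 < φ t := by
  have hI : ∀ s, HasDerivAt (fun s ↦ Real.exp (-∫ τ in (0 : ℝ)..s, k τ))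
      (Real.exp (-∫ τ in (0 : ℝ)..s, k τ) * -k s) s :=
    fun s ↦ (hk.integral_hasStrictDerivAt 0 s).hasDerivAt.neg.exp
  have hd : ∀ s, HasDerivAt (fun s ↦ φ s * Real.exp (-∫ τ in (0 : ℝ)..s, k τ)) 0 s := by
    intro s
    convert! (hφ s).mul (hI s) using 1
    ring
  have h := is_const_of_deriv_eq_zero (fun s ↦ (hd s).differentiableAt) (fun s ↦ (hd s).deriv) t 0
  simp only [intervalIntegral.integral_same, neg_zero, Real.exp_zero, mul_one] at h
  exact pos_of_mul_pos_left (h ▸ h0) (Real.exp_pos _).le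

/-- The planar system `x' = (a₁ x + a₂ y) y`, `y' = k x` with `a₁ a₂ = 0` and `k` bounded below by a
positive constant drifts away from the `x`-axis. -/
theorem false_of_drift {a₁ a₂ c M : ℝ} (ha : a₁ * a₂ = 0) (hc : 0 < c) {x y k : ℝ → ℝ}
    (hx : ∀ s, HasDerivAt x ((a₁ * x s + a₂ * y s) * y s) s)
    (hy : ∀ s, HasDerivAt y (x s * k s) s) (hk : ∀ s ≥ 0, c ≤ k s) (hy0 : y 0 = 0)
    (hx0 : x 0 ≠ 0) (h₁ : 0 ≤ a₁ * x 0) (h₂ : 0 ≤ a₂ * x 0) (hM : ∀ s ≥ 0, |y s| ≤ M) : False := by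
  wlog hpos : 0 < x 0 generalizing x y a₁ a₂
  · refine this (a₁ := -a₁) (a₂ := -a₂) (x := fun s ↦ -x s) (y := fun s ↦ -y s) (by linarith)
      (fun s ↦ ?_) (fun s ↦ ?_) (by simpa) (by simpa) (by linarith) (by linarith)
      (fun s hs ↦ by simpa using hM s hs) ?_
    · convert! (hx s).neg using 1
      ring
    · convert! (hy s).neg using 1
      ring
    · exact neg_pos.2 (lt_of_le_of_ne (not_lt.1 hpos) hx0)
  have ha₁ : 0 ≤ a₁ := nonneg_of_mul_nonneg_left h₁ hpos
  have ha₂ : 0 ≤ a₂ := nonneg_of_mul_nonneg_left h₂ hpos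
  have hxge : ∀ t ≥ 0, x 0 ≤ x t := by
    intro t ht
    rcases mul_eq_zero.1 ha with h | h
    · exact le_of_hasDerivAt_nonneg hx (fun s _ ↦ by
        rw [h, zero_mul, zero_add, mul_assoc]
        exact mul_nonneg ha₂ (mul_self_nonneg _)) ht
    · have hyc : Continuous y := continuous_iff_continuousAt.2 fun s ↦ (hy s).continuousAt
      have hxpos := pos_of_hasDerivAt_mul_self (φ := x) (k := fun s ↦ a₁ * y s) (by fun_prop)
        (fun s ↦ by
          convert! hx s using 1
          rw [h]
          ring) hpos
      have hynn : ∀ s ≥ 0, 0 ≤ y s := fun s hs ↦ hy0 ▸ le_of_hasDerivAt_nonneg hy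
        (fun s hs ↦ mul_nonneg (hxpos s).le (hc.le.trans (hk s hs))) hs
      exact le_of_hasDerivAt_nonneg hx (fun s hs ↦ by
        rw [h, zero_mul, add_zero]
        exact mul_nonneg (mul_nonneg ha₁ (hxpos s).le) (hynn s hs)) ht
  exact false_of_le_deriv_of_bounded (mul_pos hpos hc) hy
    (fun s hs ↦ mul_le_mul (hxge s hs) (hk s hs) hc.le (hpos.le.trans (hxge s hs)))
    (fun s hs ↦ (le_abs_self _).trans (hM s hs))

end Lyapunov

section ReducedSystem

open Set Metric Filter Topology

/-- The Euler equation of a three-dimensional metric Lie algebra, in an orthonormal frame whose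
first vector is a stationary direction. -/
structure IsReducedSolution (b c d e f h : ℝ) (p u v : ℝ → ℝ) : Prop where
  fst (t : ℝ) : HasDerivAt p
    (d * u t * v t + e * v t ^ 2 - f * u t ^ 2 - h * u t * v t) t
  snd (t : ℝ) : HasDerivAt u (p t * (f * u t + h * v t) - v t * (b * u t + c * v t)) t
  trd (t : ℝ) : HasDerivAt v (u t * (b * u t + c * v t) - p t * (d * u t + e * v t)) t

/-- The closed cube of half-width `r` around `(ρ, 0, 0)`. -/
structure InBox (ρ r p u v : ℝ) : Prop where
  fst : |p - ρ| ≤ r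
  snd : |u| ≤ r
  trd : |v| ≤ r

theorem exists_forall_inBox_pos {ρ : ℝ} (hρ : 0 < ρ) {G : ℝ × ℝ × ℝ → ℝ}
    (hG : ContinuousAt G (ρ, 0, 0)) (h0 : 0 < G (ρ, 0, 0)) :
    ∃ r > 0, r < ρ ∧ ∀ p u v, InBox ρ r p u v → 0 < G (p, u, v) := by
  obtain ⟨r, hr, hball⟩ := Metric.mem_nhds_iff.1 (hG.eventually (lt_mem_nhds h0))
  refine ⟨min r ρ / 2, by positivity, by linarith [min_le_right r ρ], fun p u v hb ↦ hball ?_⟩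
  have hlt : min r ρ / 2 < r := by linarith [min_le_left r ρ, lt_min hr hρ]
  rw [mem_ball, Prod.dist_eq, Prod.dist_eq, max_lt_iff, max_lt_iff]
  simp only [Real.dist_eq, sub_zero]
  exact ⟨hb.fst.trans_lt hlt, hb.snd.trans_lt hlt, hb.trd.trans_lt hlt⟩

/-- A Lyapunov function for the equilibrium `(ρ, 0, 0)` of the reduced system on the invariant
sphere `p² + u² + v² = ρ²`. -/
structure IsLyapunov (b c d e f h ρ r : ℝ) (F : ℝ → ℝ → ℝ → ℝ) : Prop where
  pos : 0 < r
  lt : r < ρ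
  continuousOn : ContinuousOn (fun z : ℝ × ℝ × ℝ ↦ F z.1 z.2.1 z.2.2)
    {z | InBox ρ r z.1 z.2.1 z.2.2}
  eq_zero : F ρ 0 0 = 0
  nonneg (p u v : ℝ) : InBox ρ r p u v → 0 ≤ F p u v
  definite (p u v : ℝ) : InBox ρ r p u v → F p u v = 0 → p ^ 2 + u ^ 2 + v ^ 2 = ρ ^ 2 →
    u = 0 ∧ v = 0
  deriv_nonpos (p u v : ℝ → ℝ) : IsReducedSolution b c d e f h p u v →
    ∀ t, InBox ρ r (p t) (u t) (v t) →
      ∃ D ≤ 0, HasDerivAt (fun s ↦ F (p s) (u s) (v s)) D t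

/-- Solutions of the reduced system starting close to `(ρ, 0, 0)`, on the plane `p = ρ`, stay
close to it. -/
def HasConfinedSolutions (b c d e f h ρ : ℝ) : Prop :=
  ∀ ε > 0, ∃ δ > 0, ∀ u₀ v₀ : ℝ, |u₀| < δ → |v₀| < δ → ∃ p u v : ℝ → ℝ,
    IsReducedSolution b c d e f h p u v ∧ u 0 = u₀ ∧ v 0 = v₀ ∧
      ∀ t ≥ 0, InBox ρ ε (p t) (u t) (v t)

/-- In every direction there are arbitrarily small confined solutions. -/
theorem HasConfinedSolutions.exists_smul {b c d e f h ρ : ℝ}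
    (hc : HasConfinedSolutions b c d e f h ρ) {ε : ℝ} (hε : 0 < ε) (u₀ v₀ : ℝ) :
    ∃ τ > 0, ∀ σ, |σ| = τ → ∃ p u v : ℝ → ℝ, IsReducedSolution b c d e f h p u v ∧ u 0 = σ * u₀ ∧
      v 0 = σ * v₀ ∧ ∀ t ≥ 0, InBox ρ ε (p t) (u t) (v t) := by
  obtain ⟨δ, hδ, H⟩ := hc ε hε
  have hpos : 0 < |u₀| + |v₀| + 1 := by positivity
  refine ⟨δ / (|u₀| + |v₀| + 1), by positivity, fun σ hσ ↦ H _ _ ?_ ?_⟩ <;>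
  · rw [abs_mul, hσ, div_mul_eq_mul_div, div_lt_iff₀ hpos]
    have h1 := abs_nonneg u₀
    have h2 := abs_nonneg v₀
    nlinarith

variable {b c d e f h ρ : ℝ}

theorem isLyapunov_of_eq_zero (hρ : 0 < ρ) :
    IsLyapunov b c 0 0 0 0 ρ (ρ / 2) fun p _ _ ↦ (p - ρ) ^ 2 where
  pos := by positivity
  lt := by linarith
  continuousOn := by fun_prop
  eq_zero := by ring
  nonneg p u v _ := sq_nonneg _
  definite p u v _ h0 hn := by
    have hp : p = ρ := by linarith [pow_eq_zero_iff two_ne_zero |>.1 h0]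
    subst hp
    constructor <;> nlinarith [sq_nonneg u, sq_nonneg v]
  deriv_nonpos p u v hs t _ :=
    ⟨_, le_of_eq (by ring), ((hs.fst t).sub_const ρ).pow 2⟩

theorem isLyapunov_of_nonpos_of_pos (hρ : 0 < ρ) (ht : f - e ≤ 0) (hD : 0 < d * h - e * f) :
    IsLyapunov 0 0 d e f h ρ (ρ / 2) fun _ u v ↦
      (f * u + h * v) ^ 2 + (d * u + e * v) ^ 2 + (d * h - e * f) * (u ^ 2 + v ^ 2) where
  pos := by positivity
  lt := by linarith
  continuousOn := by fun_prop
  eq_zero := by ring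
  nonneg p u v _ := by positivity
  definite p u v _ h0 _ := by
    have : (d * h - e * f) * (u ^ 2 + v ^ 2) = 0 := le_antisymm
      (by linarith [sq_nonneg (f * u + h * v), sq_nonneg (d * u + e * v)]) (by positivity)
    have h2 := (mul_eq_zero.1 this).resolve_left hD.ne'
    constructor <;> nlinarith [sq_nonneg u, sq_nonneg v]
  deriv_nonpos p u v hs t hb := by
    have hp : 0 ≤ p t := by linarith [(abs_le.1 hb.fst).1]
    refine ⟨2 * (f - e) * p t * ((f * u t + h * v t) ^ 2 + (d * u t + e * v t) ^ 2), ?_, ?_⟩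
    · have : 0 ≤ p t * ((f * u t + h * v t) ^ 2 + (d * u t + e * v t) ^ 2) := by positivity
      nlinarith
    · have hu := hs.snd t
      have hv := hs.trd t
      convert! ((((hu.const_mul f).add (hv.const_mul h)).pow 2).add
        (((hu.const_mul d).add (hv.const_mul e)).pow 2)).add
          (((hu.pow 2).add (hv.pow 2)).const_mul (d * h - e * f)) using 1
      simp only [Pi.add_apply]
      ring

theorem exists_isLyapunov_of_rank_one {m₁ m₂ n₁ n₂ n₃ : ℝ} (hρ : 0 < ρ)
    (ht : m₁ * n₃ - m₂ * n₂ < 0) :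
    ∃ r, IsLyapunov (n₁ * m₁) (n₁ * m₂) (n₂ * m₁) (n₂ * m₂) (n₃ * m₁) (n₃ * m₂) ρ r fun p u v ↦
      (m₁ * u + m₂ * v) ^ 2 + (n₁ * (p - ρ) + n₂ * u + n₃ * v) ^ 2 := by
  obtain ⟨r, hr, hrρ, hG⟩ := exists_forall_inBox_pos hρ
    (G := fun z ↦ -(z.1 * (m₁ * n₃ - m₂ * n₂) + n₁ * (m₂ * z.2.1 - m₁ * z.2.2)))
    (by fun_prop) (by nlinarith)
  refine ⟨r, hr, hrρ, by fun_prop, by ring, fun p u v _ ↦ by positivity, fun p u v hb h0 hn ↦ ?_,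
    fun p u v hs t hb ↦ ?_⟩
  · have hx : m₁ * u + m₂ * v = 0 := by
      nlinarith [sq_nonneg (m₁ * u + m₂ * v), sq_nonneg (n₁ * (p - ρ) + n₂ * u + n₃ * v)]
    have hz : n₁ * (p - ρ) + n₂ * u + n₃ * v = 0 := by
      nlinarith [sq_nonneg (m₁ * u + m₂ * v), sq_nonneg (n₁ * (p - ρ) + n₂ * u + n₃ * v)]
    have hG' := hG p u v hb
    simp only at hG'
    have hm : 0 < m₁ ^ 2 + m₂ ^ 2 := by
      by_contra! hle
      have h1 : m₁ = 0 := by nlinarith [sq_nonneg m₁, sq_nonneg m₂]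
      have h2 : m₂ = 0 := by nlinarith [sq_nonneg m₁, sq_nonneg m₂]
      simp [h1, h2] at ht
    have hprod : ((p + ρ) * (m₁ * n₃ - m₂ * n₂) - n₁ * (m₁ * v - m₂ * u)) *
        (m₁ * v - m₂ * u) = 0 := by
      linear_combination (p + ρ) * (m₁ ^ 2 + m₂ ^ 2) * hz
        - n₁ * (m₁ ^ 2 + m₂ ^ 2) * hn
        + (-(p + ρ) * (n₂ * m₁ + n₃ * m₂) + n₁ * (m₁ * u + m₂ * v)) * hx
    have hy : m₁ * v - m₂ * u = 0 := by
      refine (mul_eq_zero.1 hprod).resolve_left (ne_of_lt ?_)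
      nlinarith
    constructor
    · have : (m₁ ^ 2 + m₂ ^ 2) * u = 0 := by linear_combination m₁ * hx - m₂ * hy
      exact (mul_eq_zero.1 this).resolve_left hm.ne'
    · have : (m₁ ^ 2 + m₂ ^ 2) * v = 0 := by linear_combination m₂ * hx + m₁ * hy
      exact (mul_eq_zero.1 this).resolve_left hm.ne'
  · have hG' := hG _ _ _ hb
    simp only at hG'
    have hp := hs.fst t
    have hu := hs.snd t
    have hv := hs.trd t
    refine ⟨2 * (m₁ * u t + m₂ * v t) ^ 2 *
      (p t * (m₁ * n₃ - m₂ * n₂) + n₁ * (m₂ * u t - m₁ * v t)),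
      mul_nonpos_of_nonneg_of_nonpos (by positivity) (by linarith), ?_⟩
    convert! (((hu.const_mul m₁).add (hv.const_mul m₂)).pow 2).add
      (((((hp.sub_const ρ).const_mul n₁).add (hu.const_mul n₂)).add (hv.const_mul n₃)).pow 2) using 1
    simp only [Pi.add_apply]
    ring

theorem not_hasConfinedSolutions_of_rank_one {m₁ m₂ n₁ n₂ n₃ : ℝ} (hρ : 0 < ρ)
    (ht : 0 < m₁ * n₃ - m₂ * n₂) :
    ¬ HasConfinedSolutions (n₁ * m₁) (n₁ * m₂) (n₂ * m₁) (n₂ * m₂) (n₃ * m₁) (n₃ * m₂) ρ := by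
  intro hc
  obtain ⟨r, hr, -, hG⟩ := exists_forall_inBox_pos hρ
    (G := fun z ↦ z.1 * (m₁ * n₃ - m₂ * n₂) + n₁ * (m₂ * z.2.1 - m₁ * z.2.2)
      - ρ * (m₁ * n₃ - m₂ * n₂) / 2)
    (by fun_prop) (by simp only; nlinarith)
  obtain ⟨τ, hτ, H⟩ := hc.exists_smul hr m₁ m₂
  obtain ⟨p, u, v, hs, hu0, hv0, hb⟩ := H τ (abs_of_pos hτ)
  have hm : 0 < m₁ ^ 2 + m₂ ^ 2 := by
    by_contra! hle
    have h1 : m₁ = 0 := by nlinarith [sq_nonneg m₁, sq_nonneg m₂]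
    have h2 : m₂ = 0 := by nlinarith [sq_nonneg m₁, sq_nonneg m₂]
    simp [h1, h2] at ht
  refine false_of_mul_le_deriv_of_bounded (φ := fun s ↦ (m₁ * u s + m₂ * v s) ^ 2)
    (c := ρ * (m₁ * n₃ - m₂ * n₂)) (M := ((|m₁| + |m₂|) * r) ^ 2) (by positivity)
    (fun s ↦ (((hs.snd s).const_mul m₁).add ((hs.trd s).const_mul m₂)).pow 2)
    (fun s hs ↦ ?_) ?_ fun s hs ↦ ?_
  · have hG' := hG _ _ _ (hb s hs)
    simp only [Pi.add_apply] at hG' ⊢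
    have := mul_nonneg (sq_nonneg (m₁ * u s + m₂ * v s)) hG'.le
    norm_num
    linarith
  · rw [hu0, hv0]
    have : m₁ * (τ * m₁) + m₂ * (τ * m₂) = τ * (m₁ ^ 2 + m₂ ^ 2) := by ring
    rw [this]
    positivity
  · rw [← sq_abs]
    gcongr
    calc |m₁ * u s + m₂ * v s| ≤ |m₁| * |u s| + |m₂| * |v s| := by
          rw [← abs_mul, ← abs_mul]; exact abs_add_le _ _
      _ ≤ |m₁| * r + |m₂| * r := by gcongr; exacts [(hb s hs).snd, (hb s hs).trd]
      _ = (|m₁| + |m₂|) * r := by ring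

end ReducedSystem

section InstabilityOfReducedSystem

variable {b c d e f h ρ : ℝ}

theorem not_hasConfinedSolutions_of_neg (hρ : 0 < ρ) (hD : d * h - e * f < 0) :
    ¬ HasConfinedSolutions b c d e f h ρ := by
  intro hc
  obtain ⟨K, hKdef⟩ : ∃ K, K = |f + e| + |h - d| := ⟨_, rfl⟩
  have hK : 0 < K := by
    by_contra! hle
    have h1 : f + e = 0 := abs_nonpos_iff.1 (by linarith [abs_nonneg (h - d)])
    have h2 : h - d = 0 := abs_nonpos_iff.1 (by linarith [abs_nonneg (f + e)])
    obtain rfl : e = -f := by linarith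
    obtain rfl : d = h := by linarith
    nlinarith [sq_nonneg d, sq_nonneg f]
  obtain ⟨r, hr, -, hG⟩ := exists_forall_inBox_pos hρ
    (G := fun z ↦ z.1 * (e * f - d * h) - ρ * (e * f - d * h) / 2
      - K * |b * z.2.1 + c * z.2.2|) (by fun_prop) (by simp only; norm_num; nlinarith)
  obtain ⟨u₀, v₀, h₀⟩ : ∃ u₀ v₀ : ℝ,
      0 < (f + e) / 2 * (u₀ ^ 2 - v₀ ^ 2) + (h - d) * (u₀ * v₀) := by
    rcases lt_trichotomy (f + e) 0 with hfe | hfe | hfe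
    · exact ⟨0, 1, by linarith⟩
    · refine ⟨1, h - d, ?_⟩
      have : h - d ≠ 0 := by
        intro h0
        simp [hKdef, hfe, h0] at hK
      rw [hfe]
      have := sq_pos_of_ne_zero this
      linarith
    · exact ⟨1, 0, by linarith⟩
  obtain ⟨τ, hτ, H⟩ := hc.exists_smul hr u₀ v₀
  obtain ⟨p, u, v, hs, hu0, hv0, hb⟩ := H τ (abs_of_pos hτ)
  have hVle : ∀ s, (f + e) / 2 * (u s ^ 2 - v s ^ 2) + (h - d) * (u s * v s) ≤
      K * (u s ^ 2 + v s ^ 2) := by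
    intro s
    have h1 : (f + e) * (u s ^ 2 - v s ^ 2) ≤ |f + e| * (u s ^ 2 + v s ^ 2) := by
      refine (le_abs_self _).trans ?_
      rw [abs_mul]
      exact mul_le_mul_of_nonneg_left
        (abs_le.2 ⟨by linarith [sq_nonneg (u s)], by linarith [sq_nonneg (v s)]⟩) (abs_nonneg _)
    have h2 : (h - d) * (2 * (u s * v s)) ≤ |h - d| * (u s ^ 2 + v s ^ 2) := by
      refine (le_abs_self _).trans ?_
      rw [abs_mul]
      exact mul_le_mul_of_nonneg_left
        (abs_le.2 ⟨by linarith [sq_nonneg (u s + v s)], by linarith [sq_nonneg (u s - v s)]⟩)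
        (abs_nonneg _)
    have h3 : 0 ≤ K * (u s ^ 2 + v s ^ 2) := by positivity
    rw [hKdef] at h3 ⊢
    linarith
  refine false_of_mul_le_deriv_of_bounded
    (φ := fun s ↦ (f + e) / 2 * (u s ^ 2 - v s ^ 2) + (h - d) * (u s * v s))
    (φ' := fun s ↦ p s * ((f * u s + h * v s) ^ 2 + (d * u s + e * v s) ^ 2
      + (e * f - d * h) * (u s ^ 2 + v s ^ 2)) + (b * u s + c * v s) *
      ((h - d) * (u s ^ 2 - v s ^ 2) - (f + e) * (2 * (u s * v s))))
    (c := ρ * (e * f - d * h) / 2 / K) (M := K * (r ^ 2 + r ^ 2))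
    (div_pos (by nlinarith) hK) (fun s ↦ ?_) (fun s hs0 ↦ ?_) ?_ fun s hs0 ↦ ?_
  · have hu := hs.snd s
    have hv := hs.trd s
    convert! (((hu.pow 2).sub (hv.pow 2)).const_mul ((f + e) / 2)).add
      ((hu.mul hv).const_mul (h - d)) using 1
    ring
  · have hG' := hG _ _ _ (hb s hs0)
    simp only at hG'
    have hp : 0 < p s := by
      have h1 := mul_nonneg hK.le (abs_nonneg (b * u s + c * v s))
      have : 0 < (p s - ρ / 2) * (e * f - d * h) := by linarith
      have := pos_of_mul_pos_left this (by linarith)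
      linarith
    have h1 : ρ * (e * f - d * h) / 2 / K *
        ((f + e) / 2 * (u s ^ 2 - v s ^ 2) + (h - d) * (u s * v s)) ≤
        ρ * (e * f - d * h) / 2 * (u s ^ 2 + v s ^ 2) := by
      calc _ ≤ ρ * (e * f - d * h) / 2 / K * (K * (u s ^ 2 + v s ^ 2)) :=
            mul_le_mul_of_nonneg_left (hVle s) (div_pos (by nlinarith) hK).le
        _ = _ := by field_simp
    have h2 : |(h - d) * (u s ^ 2 - v s ^ 2) - (f + e) * (2 * (u s * v s))| ≤
        K * (u s ^ 2 + v s ^ 2) := by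
      have h3 : |u s ^ 2 - v s ^ 2| ≤ u s ^ 2 + v s ^ 2 :=
        abs_le.2 ⟨by linarith [sq_nonneg (u s)], by linarith [sq_nonneg (v s)]⟩
      have h4 : |2 * (u s * v s)| ≤ u s ^ 2 + v s ^ 2 :=
        abs_le.2 ⟨by linarith [sq_nonneg (u s + v s)], by linarith [sq_nonneg (u s - v s)]⟩
      calc _ ≤ |h - d| * |u s ^ 2 - v s ^ 2| + |f + e| * |2 * (u s * v s)| := by
            rw [← abs_mul, ← abs_mul]
            exact abs_sub _ _
        _ ≤ |h - d| * (u s ^ 2 + v s ^ 2) + |f + e| * (u s ^ 2 + v s ^ 2) := by gcongr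
        _ = _ := by rw [hKdef]; ring
    have h5 := neg_abs_le ((b * u s + c * v s) *
      ((h - d) * (u s ^ 2 - v s ^ 2) - (f + e) * (2 * (u s * v s))))
    rw [abs_mul] at h5
    have h6 := mul_le_mul_of_nonneg_left h2 (abs_nonneg (b * u s + c * v s))
    have h7 : 0 ≤ p s * ((f * u s + h * v s) ^ 2 + (d * u s + e * v s) ^ 2) := by positivity
    have h8 := mul_nonneg hG'.le (add_nonneg (sq_nonneg (u s)) (sq_nonneg (v s)))
    linarith
  · rw [hu0, hv0]
    have := mul_pos (pow_pos hτ 2) h₀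
    linarith
  · refine (hVle s).trans (mul_le_mul_of_nonneg_left (add_le_add ?_ ?_) hK.le)
    · exact sq_le_sq' (abs_le.1 (hb s hs0).snd).1 (abs_le.1 (hb s hs0).snd).2
    · exact sq_le_sq' (abs_le.1 (hb s hs0).trd).1 (abs_le.1 (hb s hs0).trd).2

theorem not_hasConfinedSolutions_of_pos (hρ : 0 < ρ) (ht : 0 < f - e) (hD : 0 < d * h - e * f) :
    ¬ HasConfinedSolutions 0 0 d e f h ρ := by
  intro hc
  obtain ⟨K, hK⟩ : ∃ K, K = d * h - e * f + (d ^ 2 + e ^ 2 + f ^ 2 + h ^ 2) := ⟨_, rfl⟩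
  have hK0 : 0 < K := by rw [hK]; positivity
  obtain ⟨τ, hτ, H⟩ := hc.exists_smul (half_pos hρ) 1 0
  obtain ⟨p, u, v, hs, hu0, hv0, hb⟩ := H τ (abs_of_pos hτ)
  refine false_of_mul_le_deriv_of_bounded
    (φ := fun s ↦ (f * u s + h * v s) ^ 2 + (d * u s + e * v s) ^ 2
      + (d * h - e * f) * (u s ^ 2 + v s ^ 2))
    (φ' := fun s ↦ 2 * (f - e) * p s * ((f * u s + h * v s) ^ 2 + (d * u s + e * v s) ^ 2))
    (c := (f - e) * ρ * ((d * h - e * f) / K)) (M := K * ((ρ / 2) ^ 2 + (ρ / 2) ^ 2))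
    (by positivity) (fun s ↦ ?_) (fun s hs0 ↦ ?_) ?_ fun s hs0 ↦ ?_
  · have hu := hs.snd s
    have hv := hs.trd s
    convert! ((((hu.const_mul f).add (hv.const_mul h)).pow 2).add
      (((hu.const_mul d).add (hv.const_mul e)).pow 2)).add
        (((hu.pow 2).add (hv.pow 2)).const_mul (d * h - e * f)) using 1
    simp only [Pi.add_apply]
    ring
  · have hp : ρ / 2 ≤ p s := by linarith [(abs_le.1 (hb s hs0).fst).1]
    have h1 : (d * h - e * f) / K * ((f * u s + h * v s) ^ 2 + (d * u s + e * v s) ^ 2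
        + (d * h - e * f) * (u s ^ 2 + v s ^ 2)) ≤
        (f * u s + h * v s) ^ 2 + (d * u s + e * v s) ^ 2 := by
      rw [div_mul_eq_mul_div, div_le_iff₀ hK0, hK]
      have := sq_nonneg ((d * u s + e * v s) * e + (f * u s + h * v s) * h)
      have := sq_nonneg ((d * u s + e * v s) * d + (f * u s + h * v s) * f)
      linarith
    have h2 : 0 ≤ (f * u s + h * v s) ^ 2 + (d * u s + e * v s) ^ 2 := by positivity
    calc _ = (f - e) * ρ * ((d * h - e * f) / K * ((f * u s + h * v s) ^ 2
          + (d * u s + e * v s) ^ 2 + (d * h - e * f) * (u s ^ 2 + v s ^ 2))) := by ring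
      _ ≤ (f - e) * ρ * ((f * u s + h * v s) ^ 2 + (d * u s + e * v s) ^ 2) := by gcongr
      _ ≤ _ := mul_le_mul_of_nonneg_right (by nlinarith) h2
  · simp only [hu0, hv0]
    positivity
  · have h1 : u s ^ 2 ≤ (ρ / 2) ^ 2 :=
      sq_le_sq' (abs_le.1 (hb s hs0).snd).1 (abs_le.1 (hb s hs0).snd).2
    have h2 : v s ^ 2 ≤ (ρ / 2) ^ 2 :=
      sq_le_sq' (abs_le.1 (hb s hs0).trd).1 (abs_le.1 (hb s hs0).trd).2
    refine le_trans ?_ (mul_le_mul_of_nonneg_left (add_le_add h1 h2) hK0.le)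
    rw [hK]
    have := sq_nonneg (f * v s - h * u s)
    have := sq_nonneg (d * v s - e * u s)
    linarith

theorem not_hasConfinedSolutions_of_nilpotent {s m₁ m₂ : ℝ} (hρ : 0 < ρ) (hs : s ≠ 0)
    (hm : 0 < m₁ ^ 2 + m₂ ^ 2) (hbc : (b * m₁ + c * m₂) * (b * m₂ - c * m₁) = 0) :
    ¬ HasConfinedSolutions b c (s * m₁ ^ 2) (s * (m₁ * m₂)) (s * (m₁ * m₂)) (s * m₂ ^ 2) ρ := by
  intro hc
  obtain ⟨r, hr, -, hG⟩ := exists_forall_inBox_pos hρ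
    (G := fun z ↦ s ^ 2 * z.1 * (m₁ ^ 2 + m₂ ^ 2) - s * (b * z.2.1 + c * z.2.2)
      - s ^ 2 * ρ * (m₁ ^ 2 + m₂ ^ 2) / 2)
    (by fun_prop) (by
      have : 0 < s ^ 2 * ρ * (m₁ ^ 2 + m₂ ^ 2) := by positivity
      simp only
      linarith)
  obtain ⟨τ, hτ, H⟩ := hc.exists_smul hr m₁ m₂
  obtain ⟨a₁, ha₁⟩ : ∃ a, a = (b * m₁ + c * m₂) / (m₁ ^ 2 + m₂ ^ 2) / s := ⟨_, rfl⟩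
  obtain ⟨a₂, ha₂⟩ : ∃ a, a = (b * m₂ - c * m₁) / (m₁ ^ 2 + m₂ ^ 2) / s ^ 2 := ⟨_, rfl⟩
  have ha : a₁ * a₂ = 0 := by
    rw [ha₁, ha₂, div_mul_div_comm, div_mul_div_comm, hbc, zero_div, zero_div]
  obtain ⟨σ, hσ, h₁, h₂⟩ : ∃ σ, |σ| = τ ∧ 0 ≤ a₁ * σ ∧ 0 ≤ a₂ * σ := by
    rcases le_total 0 (a₁ + a₂) with hle | hle
    · refine ⟨τ, abs_of_pos hτ, ?_, ?_⟩ <;> refine mul_nonneg ?_ hτ.le <;>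
      rcases mul_eq_zero.1 ha with h0 | h0 <;> linarith
    · refine ⟨-τ, by rw [abs_neg, abs_of_pos hτ], ?_, ?_⟩ <;>
      refine mul_nonneg_of_nonpos_of_nonpos ?_ (neg_nonpos.2 hτ.le) <;>
      rcases mul_eq_zero.1 ha with h0 | h0 <;> linarith
  obtain ⟨p, u, v, hsol, hu0, hv0, hb⟩ := H σ hσ
  have hx0 : m₁ * u 0 + m₂ * v 0 = σ * (m₁ ^ 2 + m₂ ^ 2) := by
    rw [hu0, hv0]
    ring
  have hσ0 : σ ≠ 0 := by
    rintro rfl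
    simp [hτ.ne] at hσ
  refine false_of_drift (x := fun t ↦ m₁ * u t + m₂ * v t)
    (y := fun t ↦ s * (m₂ * u t - m₁ * v t))
    (k := fun t ↦ s ^ 2 * p t * (m₁ ^ 2 + m₂ ^ 2) - s * (b * u t + c * v t))
    (c := s ^ 2 * ρ * (m₁ ^ 2 + m₂ ^ 2) / 2) (M := |s| * (|m₂| * r + |m₁| * r)) ha (by positivity)
    (fun t ↦ ?_) (fun t ↦ ?_) (fun t ht ↦ ?_) ?_ ?_ ?_ ?_ fun t ht ↦ ?_
  · convert! ((hsol.snd t).const_mul m₁).add ((hsol.trd t).const_mul m₂) using 1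
    rw [ha₁, ha₂]
    field_simp
    ring
  · convert! (((hsol.snd t).const_mul m₂).sub ((hsol.trd t).const_mul m₁)).const_mul s using 1
    ring
  · linarith [hG _ _ _ (hb t ht)]
  · simp only [hu0, hv0]
    ring
  · simp only [hx0]
    positivity
  · simp only [hx0, ← mul_assoc]
    exact mul_nonneg h₁ hm.le
  · simp only [hx0, ← mul_assoc]
    exact mul_nonneg h₂ hm.le
  · rw [abs_mul]
    refine mul_le_mul_of_nonneg_left ((abs_sub _ _).trans ?_) (abs_nonneg _)
    rw [abs_mul, abs_mul]
    gcongr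
    exacts [(hb t ht).snd, (hb t ht).trd]

end InstabilityOfReducedSystem

section CenterStability

open Set Metric Filter Topology

/-- An integrating factor for the ratio `q = x / p` in the centre case: `exp (2 G)` corrects
`1 + q² / w` to a function with a strict local minimum at `0`. -/
theorem exists_integratingFactor {α β w : ℝ} (hαβ : 0 < α * β) (hw : 0 < w) :
    ∃ η > 0, ∃ G : ℝ → ℝ, Continuous G ∧ G 0 = 0 ∧
      (∀ q, |q| ≤ η → β - q - (α - β) * q ^ 2 / w ≠ 0 ∧
        HasDerivAt G ((α - β) / w * q / (β - q - (α - β) * q ^ 2 / w)) q) ∧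
      ∀ q, |q| ≤ η → q ≠ 0 → 1 < Real.exp (2 * G q) * (1 + q ^ 2 / w) := by
  have hβ : β ≠ 0 := right_ne_zero_of_mul hαβ.ne'
  obtain ⟨g, hg⟩ : ∃ g : ℝ → ℝ, g = fun q ↦ (α - β) / w * q /
      (β * max (1 - q / β - (α - β) * q ^ 2 / w / β) (1 / 2)) := ⟨_, rfl⟩
  have hgc : Continuous g := by
    rw [hg]
    refine Continuous.div (by fun_prop) (by fun_prop) fun q ↦ mul_ne_zero hβ ?_
    exact (lt_max_of_lt_right (by norm_num)).ne'
  obtain ⟨η, hη, hηP, hηα⟩ : ∃ η > 0,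
      (∀ q, |q| ≤ η → 1 / 2 < 1 - q / β - (α - β) * q ^ 2 / w / β) ∧
      ∀ q, |q| ≤ η → 0 < (α - q) * β := by
    have h1 : ∀ᶠ q in 𝓝 (0 : ℝ), 1 / 2 < 1 - q / β - (α - β) * q ^ 2 / w / β :=
      (show ContinuousAt (fun q : ℝ ↦ 1 - q / β - (α - β) * q ^ 2 / w / β) 0 by fun_prop).eventually
        (lt_mem_nhds (by norm_num))
    have h2 : ∀ᶠ q in 𝓝 (0 : ℝ), 0 < (α - q) * β :=
      (show ContinuousAt (fun q : ℝ ↦ (α - q) * β) 0 by fun_prop).eventually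
        (lt_mem_nhds (by simpa))
    obtain ⟨η, hη, hball⟩ := Metric.eventually_nhds_iff.1 (h1.and h2)
    refine ⟨η / 2, by positivity, fun q hq ↦ (hball ?_).1, fun q hq ↦ (hball ?_).2⟩ <;>
    · rw [Real.dist_eq, sub_zero]
      linarith
  have hP : ∀ q, β - q - (α - β) * q ^ 2 / w = β * (1 - q / β - (α - β) * q ^ 2 / w / β) := by
    intro q
    field_simp
  have hG : ∀ q, HasDerivAt (fun q ↦ ∫ τ in (0 : ℝ)..q, g τ) (g q) q :=
    fun q ↦ (hgc.integral_hasStrictDerivAt 0 q).hasDerivAt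
  obtain ⟨G, hGdef⟩ : ∃ G : ℝ → ℝ, G = fun q ↦ ∫ τ in (0 : ℝ)..q, g τ := ⟨_, rfl⟩
  rw [← hGdef] at hG
  have hG0 : G 0 = 0 := by simp [hGdef]
  have hgP : ∀ q, |q| ≤ η → g q = (α - β) / w * q / (β - q - (α - β) * q ^ 2 / w) := by
    intro q hq
    rw [hg, hP]
    simp only
    rw [max_eq_left (hηP q hq).le]
  have hPne : ∀ q, |q| ≤ η → β - q - (α - β) * q ^ 2 / w ≠ 0 := by
    intro q hq
    rw [hP]
    exact mul_ne_zero hβ (by linarith [hηP q hq])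
  have hMd : ∀ q, |q| ≤ η → ∃ m > 0,
      HasDerivAt (fun q ↦ Real.exp (2 * G q) * (1 + q ^ 2 / w)) (q * m) q := by
    intro q hq
    refine ⟨Real.exp (2 * G q) * (2 / w) * ((α - q) / (β - q - (α - β) * q ^ 2 / w)), ?_, ?_⟩
    · refine mul_pos (by positivity) ?_
      have h1 : 0 < β * (β - q - (α - β) * q ^ 2 / w) := by
        rw [hP, ← mul_assoc]
        exact mul_pos (mul_self_pos.2 hβ) (by linarith [hηP q hq])
      have h2 : (α - q) / (β - q - (α - β) * q ^ 2 / w) =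
          (α - q) * β / (β * (β - q - (α - β) * q ^ 2 / w)) := by
        rw [mul_comm β, mul_div_mul_right _ _ hβ]
      rw [h2]
      exact div_pos (hηα q hq) h1
    · have hPq := hPne q hq
      convert! ((hG q).const_mul 2).exp.mul
        ((((hasDerivAt_id q).pow 2).div_const w).const_add 1) using 1
      rw [hgP q hq]
      obtain ⟨P, hPe⟩ : ∃ P, P = β - q - (α - β) * q ^ 2 / w := ⟨_, rfl⟩
      rw [← hPe] at hPq ⊢
      have hα : α - q = (α - β) * (1 + q ^ 2 / w) + P := by
        rw [hPe]
        ring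
      rw [hα]
      simp only [id, Pi.pow_apply]
      field_simp
      ring
  refine ⟨η, hη, G, continuous_iff_continuousAt.2 fun q ↦ (hG q).continuousAt, hG0,
    fun q hq ↦ ⟨hPne q hq, hgP q hq ▸ hG q⟩, fun q hq hq0 ↦ ?_⟩
  choose! m hm hMd using hMd
  have hM0 : Real.exp (2 * G 0) * (1 + 0 ^ 2 / w) = 1 := by simp [hG0]
  refine hM0.symm.trans_lt ?_
  rcases hq0.lt_or_gt with hneg | hpos
  · have hmem : ∀ s ∈ Icc q 0, |s| ≤ η := fun s hs ↦ by
      rw [abs_of_nonpos hs.2]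
      rw [abs_of_neg hneg] at hq
      linarith [hs.1]
    refine strictAntiOn_of_hasDerivWithinAt_neg (convex_Icc q 0)
      (f := fun q ↦ Real.exp (2 * G q) * (1 + q ^ 2 / w)) (f' := fun s ↦ s * m s)
      (fun s hs ↦ (hMd s (hmem s hs)).continuousAt.continuousWithinAt)
      (fun s hs ↦ (hMd s (hmem s (interior_subset hs))).hasDerivWithinAt) (fun s hs ↦ ?_)
      ⟨le_rfl, hneg.le⟩ ⟨hneg.le, le_rfl⟩ hneg
    have hs' := hm s (hmem s (interior_subset hs))
    rw [interior_Icc] at hs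
    exact mul_neg_of_neg_of_pos hs.2 hs'
  · have hmem : ∀ s ∈ Icc 0 q, |s| ≤ η := fun s hs ↦ by
      rw [abs_of_nonneg hs.1]
      rw [abs_of_pos hpos] at hq
      linarith [hs.2]
    refine strictMonoOn_of_hasDerivWithinAt_pos (convex_Icc 0 q)
      (f := fun q ↦ Real.exp (2 * G q) * (1 + q ^ 2 / w)) (f' := fun s ↦ s * m s)
      (fun s hs ↦ (hMd s (hmem s hs)).continuousAt.continuousWithinAt)
      (fun s hs ↦ (hMd s (hmem s (interior_subset hs))).hasDerivWithinAt) (fun s hs ↦ ?_)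
      ⟨le_rfl, hpos.le⟩ ⟨hpos.le, le_rfl⟩ hpos
    have hs' := hm s (hmem s (interior_subset hs))
    rw [interior_Icc] at hs
    exact mul_pos hs.1 hs'

theorem exists_isLyapunov_of_center {b c d e h α β ρ : ℝ} (hρ : 0 < ρ) (hαβ : 0 < α * β)
    (hw : 0 < b ^ 2 + c ^ 2) (hd : d * (b ^ 2 + c ^ 2) = α * b ^ 2 + β * c ^ 2)
    (he : e * (b ^ 2 + c ^ 2) = (α - β) * (b * c))
    (hh : h * (b ^ 2 + c ^ 2) = α * c ^ 2 + β * b ^ 2) :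
    ∃ r F, IsLyapunov b c d e e h ρ r F := by
  obtain ⟨w, hwdef⟩ : ∃ w, w = b ^ 2 + c ^ 2 := ⟨_, rfl⟩
  rw [← hwdef] at hw hd he hh
  obtain ⟨η, hη, G, hGc, hG0, hGd, hM⟩ := exists_integratingFactor hαβ hw
  obtain ⟨r, hr, hrρ, hbox⟩ := exists_forall_inBox_pos hρ
    (G := fun z ↦ η * z.1 - |b * z.2.1 + c * z.2.2|) (by fun_prop)
    (by simp only; norm_num; positivity)
  have hp : ∀ p u v, InBox ρ r p u v → 0 < p := fun p u v hb ↦ by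
    linarith [(abs_le.1 hb.fst).1]
  have hq : ∀ p u v, InBox ρ r p u v → |(b * u + c * v) / p| ≤ η := fun p u v hb ↦ by
    have hp := hp p u v hb
    rw [abs_div, abs_of_pos hp, div_le_iff₀ hp]
    linarith [hbox p u v hb]
  have hsplit : ∀ p u v, InBox ρ r p u v →
      (p ^ 2 + u ^ 2 + v ^ 2) / p ^ 2 * Real.exp (2 * G ((b * u + c * v) / p)) - 1 =
      (Real.exp (2 * G ((b * u + c * v) / p)) * (1 + ((b * u + c * v) / p) ^ 2 / w) - 1) +
      Real.exp (2 * G ((b * u + c * v) / p)) * ((b * v - c * u) ^ 2 / (w * p ^ 2)) := by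
    intro p u v hb
    have hp := hp p u v hb
    have : (p ^ 2 + u ^ 2 + v ^ 2) / p ^ 2 = (1 + ((b * u + c * v) / p) ^ 2 / w) +
        (b * v - c * u) ^ 2 / (w * p ^ 2) := by
      field_simp
      rw [hwdef]
      ring
    rw [this]
    ring
  have hM' : ∀ q, |q| ≤ η → 0 ≤ Real.exp (2 * G q) * (1 + q ^ 2 / w) - 1 := by
    intro q hq
    rcases eq_or_ne q 0 with rfl | hq0
    · simp [hG0]
    · linarith [hM q hq hq0]
  refine ⟨r, fun p u v ↦ (p ^ 2 + u ^ 2 + v ^ 2) / p ^ 2 *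
    Real.exp (2 * G ((b * u + c * v) / p)) - 1, hr, hrρ, ?_, ?_, ?_, ?_, ?_⟩
  · have hne : ∀ z ∈ {z : ℝ × ℝ × ℝ | InBox ρ r z.1 z.2.1 z.2.2}, z.1 ≠ 0 :=
      fun z hz ↦ (hp _ _ _ hz).ne'
    refine ((ContinuousOn.div (by fun_prop) (by fun_prop) fun z hz ↦ pow_ne_zero 2 (hne z hz)).mul
      (Real.continuous_exp.comp_continuousOn (continuousOn_const.mul
        (hGc.comp_continuousOn (ContinuousOn.div (by fun_prop) (by fun_prop) hne))))).sub
      continuousOn_const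
  · simp [hG0, hρ.ne']
  · intro p u v hb
    rw [hsplit p u v hb]
    have := hM' _ (hq p u v hb)
    positivity
  · intro p u v hb h0 _
    have hp := hp p u v hb
    rw [hsplit p u v hb] at h0
    have h1 := hM' _ (hq p u v hb)
    have h2 : 0 ≤ Real.exp (2 * G ((b * u + c * v) / p)) *
      ((b * v - c * u) ^ 2 / (w * p ^ 2)) := by positivity
    have hx : b * u + c * v = 0 := by
      by_contra hne
      have := hM _ (hq p u v hb) (div_ne_zero hne hp.ne')
      linarith
    have hy : b * v - c * u = 0 := by
      by_contra hne
      have : 0 < Real.exp (2 * G ((b * u + c * v) / p)) *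
        ((b * v - c * u) ^ 2 / (w * p ^ 2)) := by positivity
      linarith
    constructor
    · have : w * u = 0 := by rw [hwdef]; linear_combination b * hx - c * hy
      exact (mul_eq_zero.1 this).resolve_left hw.ne'
    · have : w * v = 0 := by rw [hwdef]; linear_combination c * hx + b * hy
      exact (mul_eq_zero.1 this).resolve_left hw.ne'
  · intro p u v hs t hb
    have hpt := hp _ _ _ hb
    obtain ⟨hP, hGt⟩ := hGd _ (hq _ _ _ hb)
    refine ⟨0, le_rfl, ?_⟩
    have h1 : b * e - c * d = -β * c := mul_right_cancel₀ hw.ne' (by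
      rw [sub_mul, mul_assoc, mul_assoc, he, hd, hwdef]; ring)
    have h2 : b * h - c * e = β * b := mul_right_cancel₀ hw.ne' (by
      rw [sub_mul, mul_assoc, mul_assoc, he, hh, hwdef]; ring)
    have h3 : d - h = (α - β) * (b ^ 2 - c ^ 2) / w := by
      rw [eq_div_iff hw.ne', sub_mul, hd, hh]; ring
    have h4 : e = (α - β) * (b * c) / w := by rw [eq_div_iff hw.ne', he]
    have hdp : HasDerivAt p
        ((α - β) * ((b * u t + c * v t) * (b * v t - c * u t)) / w) t := by
      convert! hs.fst t using 1
      have : d * u t * v t + e * v t ^ 2 - e * u t ^ 2 - h * u t * v t =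
        (d - h) * (u t * v t) + e * (v t ^ 2 - u t ^ 2) := by ring
      rw [this, h3, h4]
      ring
    have hdx : HasDerivAt (fun s ↦ b * u s + c * v s)
        ((b * v t - c * u t) * (β * p t - (b * u t + c * v t))) t := by
      convert! ((hs.snd t).const_mul b).add ((hs.trd t).const_mul c) using 1
      linear_combination -(p t * u t) * h1 - (p t * v t) * h2
    have hdn : HasDerivAt (fun s ↦ p s ^ 2 + u s ^ 2 + v s ^ 2) 0 t := by
      convert! (((hs.fst t).pow 2).add ((hs.snd t).pow 2)).add ((hs.trd t).pow 2) using 1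
      ring
    have hdq := hdx.div hdp hpt.ne'
    have hGq := HasDerivAt.comp t hGt hdq
    convert! ((hdn.div (hdp.pow 2) (pow_ne_zero 2 hpt.ne')).mul
      (hGq.const_mul 2).exp).sub_const 1 using 1
    obtain ⟨P, hPe⟩ : ∃ P, P = β - (b * u t + c * v t) / p t
      - (α - β) * ((b * u t + c * v t) / p t) ^ 2 / w := ⟨_, rfl⟩
    simp only [Pi.div_apply, Pi.pow_apply, Function.comp_apply]
    have hq' : ((b * v t - c * u t) * (β * p t - (b * u t + c * v t)) * p t -
        (b * u t + c * v t) * ((α - β) * ((b * u t + c * v t) * (b * v t - c * u t)) / w)) /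
        p t ^ 2 = (b * v t - c * u t) * P := by
      rw [hPe]
      field_simp
    rw [← hPe] at hP ⊢
    rw [hq']
    field_simp
    ring

end CenterStability

namespace OrthonormalBasis

variable {g : Type*} [NormedAddCommGroup g] [InnerProductSpace ℝ g]

theorem inner_smul_add_smul_add_smul (B : OrthonormalBasis (Fin 3) ℝ g) (p u v : ℝ) :
    ⟪B 0, p • B 0 + u • B 1 + v • B 2⟫_ℝ = p ∧ ⟪B 1, p • B 0 + u • B 1 + v • B 2⟫_ℝ = u ∧
      ⟪B 2, p • B 0 + u • B 1 + v • B 2⟫_ℝ = v := by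
  simp [inner_add_right, real_inner_smul_right, B.inner_eq_ite]

theorem eq_add_inner_smul (B : OrthonormalBasis (Fin 3) ℝ g) (y : g) :
    y = ⟪B 0, y⟫_ℝ • B 0 + ⟪B 1, y⟫_ℝ • B 1 + ⟪B 2, y⟫_ℝ • B 2 := by
  conv_lhs => rw [← B.sum_repr' y, Fin.sum_univ_three]

theorem norm_sq_eq_add_inner_sq (B : OrthonormalBasis (Fin 3) ℝ g) (y : g) :
    ‖y‖ ^ 2 = ⟪B 0, y⟫_ℝ ^ 2 + ⟪B 1, y⟫_ℝ ^ 2 + ⟪B 2, y⟫_ℝ ^ 2 := by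
  rw [← B.sum_sq_norm_inner_right y, Fin.sum_univ_three]
  simp only [Real.norm_eq_abs, sq_abs]

end OrthonormalBasis

namespace LieStructure

variable {g : Type*} [NormedAddCommGroup g] [InnerProductSpace ℝ g]

theorem bracket_swap (L : LieStructure g) (x y : g) : L.bracket x y = -L.bracket y x := by
  have h := L.bracket_self (x + y)
  simp only [map_add, LinearMap.add_apply, L.bracket_self, zero_add, add_zero] at h
  exact eq_neg_of_add_eq_zero_right h

/-- The structure constants of a three-dimensional metric Lie algebra in an orthonormal basis whose
first vector is a stationary direction. -/
structure IsAdapted (L : LieStructure g) (B : OrthonormalBasis (Fin 3) ℝ g) (l b c d e f h : ℝ) :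
    Prop where
  bracket_one_two : L.bracket (B 1) (B 2) = l • B 0 + b • B 1 + c • B 2
  bracket_two_zero : L.bracket (B 2) (B 0) = (d + l) • B 1 + e • B 2
  bracket_zero_one : L.bracket (B 0) (B 1) = f • B 1 + (h + l) • B 2

namespace IsAdapted

variable {L : LieStructure g} {B : OrthonormalBasis (Fin 3) ℝ g} {l b c d e f h ρ : ℝ}

theorem bracket_two_one (hA : L.IsAdapted B l b c d e f h) :
    L.bracket (B 2) (B 1) = -(l • B 0 + b • B 1 + c • B 2) := by
  rw [L.bracket_swap, hA.bracket_one_two]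

theorem bracket_zero_two (hA : L.IsAdapted B l b c d e f h) :
    L.bracket (B 0) (B 2) = -((d + l) • B 1 + e • B 2) := by
  rw [L.bracket_swap, hA.bracket_two_zero]

theorem bracket_one_zero (hA : L.IsAdapted B l b c d e f h) :
    L.bracket (B 1) (B 0) = -(f • B 1 + (h + l) • B 2) := by
  rw [L.bracket_swap, hA.bracket_zero_one]

theorem jacobi (hA : L.IsAdapted B l b c d e f h) :
    l * (e - f) = 0 ∧ b * e = (d + l) * c ∧ c * f = (h + l) * b := by
  have hJ := L.jacobi (B 0) (B 1) (B 2)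
  rw [hA.bracket_one_two, hA.bracket_two_zero, hA.bracket_zero_one] at hJ
  simp only [map_add, map_smul, L.bracket_self, hA.bracket_zero_one, hA.bracket_zero_two,
    hA.bracket_one_two, hA.bracket_two_one] at hJ
  have h0 := congrArg (fun z ↦ ⟪B 0, z⟫_ℝ) hJ
  have h1 := congrArg (fun z ↦ ⟪B 1, z⟫_ℝ) hJ
  have h2 := congrArg (fun z ↦ ⟪B 2, z⟫_ℝ) hJ
  simp [inner_add_right, real_inner_smul_right, B.inner_eq_ite] at h0 h1 h2
  exact ⟨by linarith, by linarith, by linarith⟩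

theorem inner_bracket (hA : L.IsAdapted B l b c d e f h) (p u v : ℝ) :
    let y := p • B 0 + u • B 1 + v • B 2
    ⟪y, L.bracket y (B 0)⟫_ℝ = d * u * v + e * v ^ 2 - f * u ^ 2 - h * u * v ∧
    ⟪y, L.bracket y (B 1)⟫_ℝ = p * (f * u + h * v) - v * (b * u + c * v) ∧
    ⟪y, L.bracket y (B 2)⟫_ℝ = u * (b * u + c * v) - p * (d * u + e * v) := by
  refine ⟨?_, ?_, ?_⟩ <;>
  · simp only [map_add, map_smul, LinearMap.add_apply, LinearMap.smul_apply, L.bracket_self,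
      hA.bracket_zero_one, hA.bracket_zero_two, hA.bracket_one_two, hA.bracket_two_one,
      hA.bracket_one_zero, hA.bracket_two_zero]
    simp [inner_add_right, inner_add_left, real_inner_smul_right, real_inner_smul_left,
      B.inner_eq_ite]
    ring

variable [FiniteDimensional ℝ g]

theorem isReducedSolution (hA : L.IsAdapted B l b c d e f h) {Y : ℝ → g} (hY : L.IsSolution Y) :
    IsReducedSolution b c d e f h (fun t ↦ ⟪B 0, Y t⟫_ℝ) (fun t ↦ ⟪B 1, Y t⟫_ℝ)
      (fun t ↦ ⟪B 2, Y t⟫_ℝ) := by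
  have hd : ∀ i t, HasDerivAt (fun t ↦ ⟪B i, Y t⟫_ℝ) ⟪Y t, L.bracket (Y t) (B i)⟫_ℝ t := by
    intro i t
    have := (hasDerivAt_const t (B i)).inner ℝ (hY t)
    rwa [inner_zero_left, add_zero, real_inner_comm, inner_adT_left] at this
  constructor <;> intro t
  · convert! hd 0 t using 1
    conv_rhs => rw [B.eq_add_inner_smul (Y t)]
    exact ((hA.inner_bracket _ _ _).1).symm
  · convert! hd 1 t using 1
    conv_rhs => rw [B.eq_add_inner_smul (Y t)]
    exact ((hA.inner_bracket _ _ _).2.1).symm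
  · convert! hd 2 t using 1
    conv_rhs => rw [B.eq_add_inner_smul (Y t)]
    exact ((hA.inner_bracket _ _ _).2.2).symm

theorem isStable (hA : L.IsAdapted B l b c d e f h) {r : ℝ} {F : ℝ → ℝ → ℝ → ℝ}
    (hF : IsLyapunov b c d e f h ρ r F) : L.IsStable (ρ • B 0) := by
  have hρ : 0 < ρ := hF.pos.trans hF.lt
  have hX : ∀ i, ⟪B i, ρ • B 0⟫_ℝ = if i = 0 then ρ else 0 := by
    intro i
    simp [real_inner_smul_right, B.inner_eq_ite]
  have hcoord : ∀ i y, |⟪B i, y⟫_ℝ - ⟪B i, ρ • B 0⟫_ℝ| ≤ ‖y - ρ • B 0‖ := by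
    intro i y
    rw [← inner_sub_right]
    exact (abs_real_inner_le_norm _ _).trans (by rw [B.norm_eq_one, one_mul])
  have hbox : ∀ y ∈ Metric.closedBall (ρ • B 0) r, InBox ρ r ⟪B 0, y⟫_ℝ ⟪B 1, y⟫_ℝ ⟪B 2, y⟫_ℝ := by
    intro y hy
    rw [mem_closedBall_iff_norm] at hy
    have h0 := (hcoord 0 y).trans hy
    have h1 := (hcoord 1 y).trans hy
    have h2 := (hcoord 2 y).trans hy
    simp [hX] at h0 h1 h2
    exact ⟨h0, h1, h2⟩
  have key := exists_forall_dist_lt_of_lyapunov (S := {Y | L.IsSolution Y})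
    (fun Y hY ↦ continuous_iff_continuousAt.2 fun t ↦ (hY t).continuousAt) (x₀ := ρ • B 0) hF.pos
    (V := fun y ↦ (‖y‖ ^ 2 - ρ ^ 2) ^ 2 + F ⟪B 0, y⟫_ℝ ⟪B 1, y⟫_ℝ ⟪B 2, y⟫_ℝ) ?_ ?_ ?_ ?_
  · intro ε hε
    obtain ⟨δ, hδ, H⟩ := key ε hε
    refine ⟨δ, hδ, fun Y hY h0 t ht ↦ ?_⟩
    rw [← dist_eq_norm] at h0 ⊢
    exact H Y hY h0 t ht
  · refine ContinuousOn.add (by fun_prop) ?_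
    exact hF.continuousOn.comp (f := fun y : g ↦ (⟪B 0, y⟫_ℝ, ⟪B 1, y⟫_ℝ, ⟪B 2, y⟫_ℝ))
      (by fun_prop) hbox
  · simp [hX, norm_smul, hF.eq_zero]
  · intro y hy hne
    have hF0 := hF.nonneg _ _ _ (hbox y hy)
    by_contra! hle
    have h1 : ‖y‖ ^ 2 - ρ ^ 2 = 0 := by
      rw [← sq_eq_zero_iff]
      exact le_antisymm (by linarith) (sq_nonneg _)
    have h2 : F ⟪B 0, y⟫_ℝ ⟪B 1, y⟫_ℝ ⟪B 2, y⟫_ℝ = 0 :=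
      le_antisymm (by linarith [sq_nonneg (‖y‖ ^ 2 - ρ ^ 2)]) hF0
    rw [B.norm_sq_eq_add_inner_sq, sub_eq_zero] at h1
    obtain ⟨hu, hv⟩ := hF.definite _ _ _ (hbox y hy) h2 h1
    have hp : 0 < ⟪B 0, y⟫_ℝ := by linarith [(abs_le.1 (hbox y hy).fst).1, hF.lt]
    have hpρ : ⟪B 0, y⟫_ℝ = ρ := by
      rw [hu, hv] at h1
      nlinarith
    rw [B.eq_add_inner_smul y, hu, hv, hpρ] at hne
    simp at hne
  · intro Y hY t ht hmem
    have hd : ∀ s ∈ Set.Icc 0 t, ∃ D ≤ 0, HasDerivAt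
        (fun s ↦ F ⟪B 0, Y s⟫_ℝ ⟪B 1, Y s⟫_ℝ ⟪B 2, Y s⟫_ℝ) D s := fun s hs ↦
      hF.deriv_nonpos _ _ _ (hA.isReducedSolution hY) s (hbox _ (hmem s hs))
    choose! D hD0 hD using hd
    have := le_of_hasDerivAt_nonpos ht hD hD0
    simp only [IsSolution.norm_eq hY t]
    linarith

theorem hasConfinedSolutions (hA : L.IsAdapted B l b c d e f h) (hst : L.IsStable (ρ • B 0)) :
    HasConfinedSolutions b c d e f h ρ := by
  intro ε hε
  obtain ⟨δ, hδ, H⟩ := hst ε hε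
  refine ⟨δ / 2, by positivity, fun u₀ v₀ hu hv ↦ ?_⟩
  obtain ⟨Y, hY, hY0⟩ := L.exists_isSolution (ρ • B 0 + u₀ • B 1 + v₀ • B 2)
  have hi := B.inner_smul_add_smul_add_smul ρ u₀ v₀
  refine ⟨_, _, _, hA.isReducedSolution hY, by rw [hY0]; exact hi.2.1, by rw [hY0]; exact hi.2.2,
    fun t ht ↦ ?_⟩
  have hlt := H Y hY (by
    rw [hY0]
    calc ‖ρ • B 0 + u₀ • B 1 + v₀ • B 2 - ρ • B 0‖ = ‖u₀ • B 1 + v₀ • B 2‖ := by congr 1; abel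
      _ ≤ |u₀| + |v₀| := (norm_add_le _ _).trans (by simp [norm_smul])
      _ < δ := by linarith) t ht
  have hcoord : ∀ i, |⟪B i, Y t⟫_ℝ - ⟪B i, ρ • B 0⟫_ℝ| ≤ ε := by
    intro i
    rw [← inner_sub_right]
    exact (abs_real_inner_le_norm _ _).trans (by rw [B.norm_eq_one, one_mul]; exact hlt.le)
  have h0 := hcoord 0
  have h1 := hcoord 1
  have h2 := hcoord 2
  simp [real_inner_smul_right, B.inner_eq_ite] at h0 h1 h2
  exact ⟨h0, h1, h2⟩

theorem toMatrix_J (hA : L.IsAdapted B l b c d e f h) :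
    LinearMap.toMatrix B.toBasis B.toBasis (L.J (ρ • B 0)) =
      !![0, 0, 0; 0, ρ * f, ρ * h; 0, -(ρ * d), -(ρ * e)] := by
  ext i j
  have h0 : LinearMap.toMatrix B.toBasis B.toBasis (L.J (ρ • B 0)) i j =
      ρ * (⟪B j, L.bracket (B 0) (B i)⟫_ℝ + ⟪B 0, L.bracket (B j) (B i)⟫_ℝ) := by
    rw [LinearMap.toMatrix_apply, B.coe_toBasis, B.coe_toBasis_repr_apply, B.repr_apply_apply]
    change ⟪B i, L.adT (ρ • B 0) (B j) + L.adT (B j) (ρ • B 0)⟫_ℝ = _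
    rw [real_inner_comm, inner_add_left, inner_adT_left, inner_adT_left, map_smul,
      LinearMap.smul_apply, real_inner_smul_left, real_inner_smul_right]
    ring
  rw [h0]
  fin_cases i <;> fin_cases j <;>
  simp [L.bracket_self, hA.bracket_zero_one, hA.bracket_zero_two, hA.bracket_one_two,
    hA.bracket_two_one, hA.bracket_one_zero, hA.bracket_two_zero, inner_add_right,
    real_inner_smul_right, B.inner_eq_ite]

theorem J_eq_zero_iff (hA : L.IsAdapted B l b c d e f h) (hρ : 0 < ρ) :
    L.J (ρ • B 0) = 0 ↔ d = 0 ∧ e = 0 ∧ f = 0 ∧ h = 0 := by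
  rw [← (LinearMap.toMatrix B.toBasis B.toBasis).map_eq_zero_iff, hA.toMatrix_J]
  constructor
  · intro hM
    have h11 := congrFun₂ hM 1 1
    have h12 := congrFun₂ hM 1 2
    have h21 := congrFun₂ hM 2 1
    have h22 := congrFun₂ hM 2 2
    simp [hρ.ne'] at h11 h12 h21 h22
    exact ⟨h21, h22, h11, h12⟩
  · rintro ⟨rfl, rfl, rfl, rfl⟩
    ext i j
    fin_cases i <;> fin_cases j <;> simp

theorem charpoly_J (hA : L.IsAdapted B l b c d e f h) :
    LinearMap.charpoly (L.J (ρ • B 0)) = Polynomial.X ^ 3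
      + Polynomial.C (ρ * (e - f)) * Polynomial.X ^ 2
      + Polynomial.C (ρ ^ 2 * (d * h - e * f)) * Polynomial.X := by
  rw [← LinearMap.charpoly_toMatrix _ B.toBasis, hA.toMatrix_J, Matrix.charpoly,
    Matrix.det_fin_three]
  simp
  ring

theorem sigmaCoeff_one (hA : L.IsAdapted B l b c d e f h) :
    sigmaCoeff 1 (L.J (ρ • B 0)) = ρ * (f - e) := by
  have hdim : Module.finrank ℝ g = 3 := by
    rw [Module.finrank_eq_card_basis B.toBasis, Fintype.card_fin]
  rw [sigmaCoeff, hdim, hA.charpoly_J]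
  simp only [Polynomial.coeff_add, Polynomial.coeff_C_mul, Polynomial.coeff_X_pow,
    Polynomial.coeff_X]
  norm_num
  ring

theorem sigmaCoeff_two (hA : L.IsAdapted B l b c d e f h) :
    sigmaCoeff 2 (L.J (ρ • B 0)) = ρ ^ 2 * (d * h - e * f) := by
  have hdim : Module.finrank ℝ g = 3 := by
    rw [Module.finrank_eq_card_basis B.toBasis, Fintype.card_fin]
  rw [sigmaCoeff, hdim, hA.charpoly_J]
  simp only [Polynomial.coeff_add, Polynomial.coeff_C_mul, Polynomial.coeff_X_pow,
    Polynomial.coeff_X]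
  norm_num

end IsAdapted

variable [FiniteDimensional ℝ g]

theorem exists_isAdapted (L : LieStructure g) (hdim : Module.finrank ℝ g = 3) {X : g}
    (hX : L.IsStationary X) (hX0 : X ≠ 0) :
    ∃ (B : OrthonormalBasis (Fin 3) ℝ g) (l b c d e f h : ℝ),
      X = ‖X‖ • B 0 ∧ L.IsAdapted B l b c d e f h := by
  have hn : ‖X‖ ≠ 0 := norm_ne_zero_iff.2 hX0
  have hon : Orthonormal ℝ (({0} : Set (Fin 3)).domRestrict fun _ ↦ ‖X‖⁻¹ • X) := by
    constructor
    · intro i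
      change ‖‖X‖⁻¹ • X‖ = 1
      rw [norm_smul, norm_inv, norm_norm, inv_mul_cancel₀ hn]
    · intro i j hij
      exact absurd (Subsingleton.elim i j) hij
  obtain ⟨B, hB⟩ := hon.exists_orthonormalBasis_extension_of_card_eq (by simpa using hdim)
  have hB0 : X = ‖X‖ • B 0 := by
    rw [hB 0 rfl, smul_smul, mul_inv_cancel₀ hn, one_smul]
  have hst : ∀ Z, ⟪B 0, L.bracket (B 0) Z⟫_ℝ = 0 := by
    intro Z
    have h : ⟪L.adT X X, Z⟫_ℝ = 0 := by rw [hX, inner_zero_left]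
    rw [inner_adT_left, hB0] at h
    simp only [map_smul, LinearMap.smul_apply,
      real_inner_smul_left, real_inner_smul_right] at h
    simpa [hn] using h
  refine ⟨B, ⟪B 0, L.bracket (B 1) (B 2)⟫_ℝ, ⟪B 1, L.bracket (B 1) (B 2)⟫_ℝ,
    ⟪B 2, L.bracket (B 1) (B 2)⟫_ℝ,
    ⟪B 1, L.bracket (B 2) (B 0)⟫_ℝ - ⟪B 0, L.bracket (B 1) (B 2)⟫_ℝ,
    ⟪B 2, L.bracket (B 2) (B 0)⟫_ℝ, ⟪B 1, L.bracket (B 0) (B 1)⟫_ℝ,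
    ⟪B 2, L.bracket (B 0) (B 1)⟫_ℝ - ⟪B 0, L.bracket (B 1) (B 2)⟫_ℝ, hB0, ?_, ?_, ?_⟩
  · exact B.eq_add_inner_smul _
  · have h0 : ⟪B 0, L.bracket (B 2) (B 0)⟫_ℝ = 0 := by
      rw [L.bracket_swap, inner_neg_right, hst, neg_zero]
    conv_lhs => rw [B.eq_add_inner_smul (L.bracket (B 2) (B 0)), h0, zero_smul, zero_add]
    rw [sub_add_cancel]
  · conv_lhs => rw [B.eq_add_inner_smul (L.bracket (B 0) (B 1)), hst, zero_smul, zero_add]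
    rw [sub_add_cancel]

end LieStructure

section Criterion

variable {l b c d e f h ρ : ℝ}

theorem exists_rank_one (hbe : b * e = d * c) (hcf : c * f = h * b) (hD : d * h - e * f = 0)
    (ht : f - e ≠ 0) :
    ∃ m₁ m₂ n₁ n₂ n₃ : ℝ, b = n₁ * m₁ ∧ c = n₁ * m₂ ∧ d = n₂ * m₁ ∧ e = n₂ * m₂ ∧ f = n₃ * m₁ ∧
      h = n₃ * m₂ := by
  rcases eq_or_ne e 0 with he | he
  · have hf : f ≠ 0 := by
      rintro rfl
      simp [he] at ht
    refine ⟨f, h, b / f, d / f, 1, ?_, ?_, ?_, ?_, ?_, ?_⟩ <;> field_simp <;> linarith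
  · refine ⟨d, e, c / e, 1, h / e, ?_, ?_, ?_, ?_, ?_, ?_⟩ <;> field_simp <;> linarith

theorem eq_zero_of_det_ne_zero (hbe : b * e = d * c) (hcf : c * f = h * b)
    (hD : d * h - e * f ≠ 0) : b = 0 ∧ c = 0 := by
  constructor
  · have : (d * h - e * f) * b = 0 := by linear_combination -f * hbe - d * hcf
    exact (mul_eq_zero.1 this).resolve_left hD
  · have : (d * h - e * f) * c = 0 := by linear_combination -h * hbe - e * hcf
    exact (mul_eq_zero.1 this).resolve_left hD

theorem exists_isLyapunov (hρ : 0 < ρ) (hl : l * (e - f) = 0) (hbe : b * e = (d + l) * c)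
    (hcf : c * f = (h + l) * b)
    (H : (d = 0 ∧ e = 0 ∧ f = 0 ∧ h = 0) ∨ (0 ≤ d * h - e * f ∧ f - e ≤ 0 ∧
      (0 < d * h - e * f ∨ f - e < 0))) :
    ∃ r F, IsLyapunov b c d e f h ρ r F := by
  rcases H with ⟨rfl, rfl, rfl, rfl⟩ | ⟨hD, ht, hlt⟩
  · exact ⟨_, _, isLyapunov_of_eq_zero hρ⟩
  rcases ht.lt_or_eq with ht' | ht'
  · obtain rfl : l = 0 := (mul_eq_zero.1 hl).resolve_right (by linarith)
    rw [add_zero] at hbe hcf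
    rcases hD.lt_or_eq with hD' | hD'
    · obtain ⟨rfl, rfl⟩ := eq_zero_of_det_ne_zero hbe hcf hD'.ne'
      exact ⟨_, _, isLyapunov_of_nonpos_of_pos hρ ht hD'⟩
    · obtain ⟨m₁, m₂, n₁, n₂, n₃, rfl, rfl, rfl, rfl, rfl, rfl⟩ :=
        exists_rank_one hbe hcf hD'.symm ht'.ne
      obtain ⟨r, hr⟩ := exists_isLyapunov_of_rank_one (n₁ := n₁) (m₁ := m₁) (m₂ := m₂) (n₂ := n₂)
        (n₃ := n₃) hρ (by linarith)
      exact ⟨r, _, hr⟩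
  · have hD' : 0 < d * h - e * f := hlt.resolve_right (by linarith)
    obtain rfl : f = e := by linarith
    by_cases hbc : b = 0 ∧ c = 0
    · obtain ⟨rfl, rfl⟩ := hbc
      exact ⟨_, _, isLyapunov_of_nonpos_of_pos hρ ht hD'⟩
    · have hw : 0 < b ^ 2 + c ^ 2 := by
        rcases not_and_or.1 hbc with h0 | h0 <;> positivity
      have hdet : (b ^ 2 + c ^ 2) * ((d + l) * (h + l) - f ^ 2) = 0 := by
        linear_combination (-b * (d + l) - c * f) * hcf + (-b * f - c * (h + l)) * hbe
      have hdet' := (mul_eq_zero.1 hdet).resolve_left hw.ne'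
      exact exists_isLyapunov_of_center (α := d + h + l) (β := -l) hρ (by linarith) hw
        (by linear_combination -c * hbe + b * hcf) (by linear_combination b * hbe + c * hcf)
        (by linear_combination c * hbe - b * hcf)

theorem not_hasConfinedSolutions (hρ : 0 < ρ) (hl : l * (e - f) = 0) (hbe : b * e = (d + l) * c)
    (hcf : c * f = (h + l) * b) (hne : ¬ (d = 0 ∧ e = 0 ∧ f = 0 ∧ h = 0))
    (H : ¬ (0 ≤ d * h - e * f ∧ f - e ≤ 0 ∧ (0 < d * h - e * f ∨ f - e < 0))) :
    ¬ HasConfinedSolutions b c d e f h ρ := by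
  rcases lt_trichotomy (d * h - e * f) 0 with hD | hD | hD
  · exact not_hasConfinedSolutions_of_neg hρ hD
  · rcases lt_trichotomy (f - e) 0 with ht | ht | ht
    · exact absurd ⟨hD.ge, ht.le, Or.inr ht⟩ H
    · obtain rfl : f = e := by linarith
      obtain ⟨s, m₁, m₂, hs, hm, rfl, rfl, rfl⟩ : ∃ s m₁ m₂ : ℝ, s ≠ 0 ∧ 0 < m₁ ^ 2 + m₂ ^ 2 ∧
          d = s * m₁ ^ 2 ∧ f = s * (m₁ * m₂) ∧ h = s * m₂ ^ 2 := by
        rcases eq_or_ne d 0 with rfl | hd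
        · obtain rfl : f = 0 := by
            rw [← mul_self_eq_zero]
            linarith
          have hh : h ≠ 0 := by
            rintro rfl
            simp at hne
          refine ⟨1 / h, 0, h, by positivity, by positivity, by simp, by simp, ?_⟩
          field_simp
        · refine ⟨1 / d, d, f, by positivity, by positivity, ?_, ?_, ?_⟩ <;> field_simp
          linarith
      refine not_hasConfinedSolutions_of_nilpotent hρ hs hm ?_
      rcases eq_or_ne l 0 with rfl | hl0
      · have : s * (m₁ ^ 2 + m₂ ^ 2) * (b * m₂ - c * m₁) = 0 := by
          linear_combination m₁ * hbe - m₂ * hcf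
        rw [(mul_eq_zero.1 this).resolve_left (mul_ne_zero hs hm.ne'), mul_zero]
      · have : l * (b * m₁ + c * m₂) = 0 := by
          linear_combination -m₂ * hbe - m₁ * hcf
        rw [(mul_eq_zero.1 this).resolve_left hl0, zero_mul]
    · obtain rfl : l = 0 := (mul_eq_zero.1 hl).resolve_right (by linarith)
      rw [add_zero] at hbe hcf
      obtain ⟨m₁, m₂, n₁, n₂, n₃, rfl, rfl, rfl, rfl, rfl, rfl⟩ :=
        exists_rank_one hbe hcf hD ht.ne'
      exact not_hasConfinedSolutions_of_rank_one hρ (by linarith)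
  · rcases le_or_gt (f - e) 0 with ht | ht
    · exact absurd ⟨hD.le, ht, Or.inl hD⟩ H
    · obtain rfl : l = 0 := (mul_eq_zero.1 hl).resolve_right (by linarith)
      rw [add_zero] at hbe hcf
      obtain ⟨rfl, rfl⟩ := eq_zero_of_det_ne_zero hbe hcf hD.ne'
      exact not_hasConfinedSolutions_of_pos hρ ht hD

end Criterion

namespace LieStructure

variable {g : Type*} [NormedAddCommGroup g] [InnerProductSpace ℝ g] [FiniteDimensional ℝ g]

theorem isStable_zero (L : LieStructure g) : L.IsStable 0 := by
  intro ε hε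
  refine ⟨ε, hε, fun Y hY h0 t _ ↦ ?_⟩
  rw [sub_zero] at h0 ⊢
  rwa [hY.norm_eq]

theorem J_zero (L : LieStructure g) : L.J 0 = 0 := by
  ext Y
  change L.adT 0 Y + L.adT Y 0 = 0
  rw [map_zero, add_zero, adT, ad, map_zero, map_zero, LinearMap.zero_apply]

theorem IsAdapted.isStable_iff {L : LieStructure g} {B : OrthonormalBasis (Fin 3) ℝ g}
    {l b c d e f h ρ : ℝ} (hA : L.IsAdapted B l b c d e f h) (hρ : 0 < ρ) :
    L.IsStable (ρ • B 0) ↔ (d = 0 ∧ e = 0 ∧ f = 0 ∧ h = 0) ∨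
      (0 ≤ d * h - e * f ∧ f - e ≤ 0 ∧ (0 < d * h - e * f ∨ f - e < 0)) := by
  obtain ⟨hl, hbe, hcf⟩ := hA.jacobi
  refine ⟨fun hst ↦ ?_, fun H ↦ ?_⟩
  · by_contra hcon
    rw [not_or] at hcon
    exact not_hasConfinedSolutions hρ hl hbe hcf hcon.1 hcon.2 (hA.hasConfinedSolutions hst)
  · obtain ⟨r, F, hF⟩ := exists_isLyapunov hρ hl hbe hcf H
    exact hA.isStable hF

end LieStructure

/-- Theorem A of Theorem 1.1: stability criterion for stationary points in dimension 3. -/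
theorem stability_iff_dim3    {g : Type*} [NormedAddCommGroup g] [InnerProductSpace ℝ g] [FiniteDimensional ℝ g]
    (L : LieStructure g) (hdim : Module.finrank ℝ g = 3)
    (X : g) (hX : L.IsStationary X) :
    L.IsStable X ↔
      (L.J X = 0 ∨
        (0 ≤ sigmaCoeff 2 (L.J X) ∧ sigmaCoeff 1 (L.J X) ≤ 0 ∧
          (0 < sigmaCoeff 2 (L.J X) ∨ sigmaCoeff 1 (L.J X) < 0))) := by
  rcases eq_or_ne X 0 with rfl | hX0
  · exact iff_of_true L.isStable_zero (Or.inl L.J_zero)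
  · obtain ⟨B, l, b, c, d, e, f, h, hXB, hA⟩ := L.exists_isAdapted hdim hX hX0
    have hρ : 0 < ‖X‖ := norm_pos_iff.2 hX0
    have hle : ‖X‖ * (f - e) ≤ 0 ↔ f - e ≤ 0 := smul_nonpos_iff_nonpos_of_pos_left hρ
    have hlt : ‖X‖ * (f - e) < 0 ↔ f - e < 0 := smul_neg_iff_of_pos_left hρ
    rw [hXB, hA.isStable_iff hρ, hA.J_eq_zero_iff hρ, hA.sigmaCoeff_one, hA.sigmaCoeff_two,
      mul_nonneg_iff_of_pos_left (by positivity), hle,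
      mul_pos_iff_of_pos_left (by positivity), hlt]
end

section
/- Let (g,⟨·,·⟩) be a metric Lie algebra with dim g = 3. Then the Euler equation has a nonzero stable stationary point. -/
open scoped InnerProductSpace

open Metric in
/-- Lyapunov's direct method for the Euler equation. -/
theorem LieStructure.isStable_of_lyapunov {g : Type*} [NormedAddCommGroup g]
    [InnerProductSpace ℝ g] [FiniteDimensional ℝ g] (L : LieStructure g) {X : g} {r : ℝ}
    (hr : 0 < r) {V : g → ℝ} (hV : ContinuousOn V (closedBall X r)) (hVX : V X = 0)
    (hpos : ∀ Y ∈ closedBall X r, Y ≠ X → 0 < V Y)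
    (hder : ∀ Y : ℝ → g, L.IsSolution Y → ∀ t, Y t ∈ closedBall X r →
      ∃ d ≤ 0, HasDerivAt (fun s => V (Y s)) d t) : L.IsStable X := by
  intro ε hε
  set ρ := min r ε with hρ
  have hρ0 : 0 < ρ := lt_min hr hε
  have hρr : closedBall X ρ ⊆ closedBall X r := closedBall_subset_closedBall (min_le_left _ _)
  obtain ⟨m, hm0, hm⟩ := (isCompact_sphere X ρ).exists_forall_le'
    (hV.mono (sphere_subset_closedBall.trans hρr)) (a := 0) (fun Y hY =>
      hpos Y (hρr (sphere_subset_closedBall hY)) (ne_of_mem_sphere hY hρ0.ne'))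
  have hcont : ContinuousAt V X := hV.continuousAt (closedBall_mem_nhds X hr)
  obtain ⟨δ, hδ0, hδ⟩ := Metric.eventually_nhds_iff_ball.1
    (hcont.eventually (gt_mem_nhds (hVX.trans_lt hm0)))
  refine ⟨min δ ρ, lt_min hδ0 hρ0, fun Y hY hY0 t ht => ?_⟩
  refine lt_of_lt_of_le ?_ (min_le_right r ε)
  by_contra! hcon
  have hYc : Continuous Y := continuous_iff_continuousAt.2 fun s => (hY s).continuousAt
  have hnc : Continuous fun s => ‖Y s - X‖ := (hYc.sub continuous_const).norm
  obtain ⟨τ, ⟨⟨hτ0, -⟩, hτρ⟩, hmin⟩ := (isCompact_Icc.inter_right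
    (isClosed_le continuous_const hnc) : IsCompact (Set.Icc 0 t ∩ {s | ρ ≤ ‖Y s - X‖})).exists_isLeast
    ⟨t, ⟨ht, le_rfl⟩, hcon⟩
  have hτt : τ ≤ t := hmin ⟨⟨ht, le_rfl⟩, hcon⟩
  have hlt : ∀ s ∈ Set.Ico 0 τ, ‖Y s - X‖ < ρ := fun s hs => by
    by_contra! h
    exact absurd (hmin ⟨⟨hs.1, hs.2.le.trans hτt⟩, h⟩) (not_le.2 hs.2)
  have hτpos : 0 < τ := by
    rcases hτ0.eq_or_lt with h | h
    · exact absurd (hY0.trans_le (min_le_right _ _)) (not_lt.2 (h ▸ hτρ))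
    · exact h
  have hle : ‖Y τ - X‖ ≤ ρ := by
    have := closure_Ico hτpos.ne
    refine (isClosed_le hnc continuous_const).closure_subset_iff.2
      (fun s hs => (hlt s hs).le) (?_ : τ ∈ closure (Set.Ico 0 τ))
    rw [this]; exact ⟨hτ0, le_rfl⟩
  have hin : ∀ s ∈ Set.Icc 0 τ, Y s ∈ closedBall X r := fun s hs => hρr <| by
    rw [mem_closedBall, dist_eq_norm]
    rcases hs.2.eq_or_lt with h | h
    · exact h ▸ hle
    · exact (hlt s ⟨hs.1, h⟩).le
  choose! d hd0 hd using fun s hs => hder Y hY s (hin s hs)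
  have hanti : AntitoneOn (fun s => V (Y s)) (Set.Icc 0 τ) := by
    refine antitoneOn_of_deriv_nonpos (convex_Icc 0 τ)
      (fun s hs => (hd s hs).continuousAt.continuousWithinAt)
      (fun s hs => (hd s (interior_subset hs)).differentiableAt.differentiableWithinAt)
      (fun s hs => ?_)
    rw [(hd s (interior_subset hs)).deriv]
    exact hd0 s (interior_subset hs)
  have h1 := hanti ⟨le_rfl, hτ0⟩ ⟨hτ0, le_rfl⟩ hτ0
  have h2 : V (Y 0) < m := hδ _ (by
    rw [mem_ball, dist_eq_norm]; exact hY0.trans_le (min_le_left _ _))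
  have h3 : m ≤ V (Y τ) := hm _ (by
    rw [mem_sphere, dist_eq_norm]; exact le_antisymm hle hτρ)
  simp only at h1
  linarith

theorem LieStructure.inner_adT {g : Type*} [NormedAddCommGroup g]
    [InnerProductSpace ℝ g] [FiniteDimensional ℝ g] (L : LieStructure g) (Y Z : g) :
    ⟪Z, L.adT Y Y⟫_ℝ = ⟪L.bracket Y Z, Y⟫_ℝ :=
  LinearMap.adjoint_inner_right _ _ _

theorem LieStructure.inner_self_adT {g : Type*} [NormedAddCommGroup g]
    [InnerProductSpace ℝ g] [FiniteDimensional ℝ g] (L : LieStructure g) (Y : g) :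
    ⟪Y, L.adT Y Y⟫_ℝ = 0 := by
  rw [L.inner_adT, L.bracket_self, inner_zero_left]

theorem LieStructure.IsSolution.hasDerivAt_inner {g : Type*} [NormedAddCommGroup g]
    [InnerProductSpace ℝ g] [FiniteDimensional ℝ g] {L : LieStructure g} {Y : ℝ → g}
    (hY : L.IsSolution Y) (Z : g) (t : ℝ) :
    HasDerivAt (fun s => ⟪Z, Y s⟫_ℝ) ⟪Z, L.adT (Y t) (Y t)⟫_ℝ t := by
  simpa using (hasDerivAt_const t Z).inner ℝ (hY t)

theorem LieStructure.IsSolution.hasDerivAt_norm_sq {g : Type*} [NormedAddCommGroup g]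
    [InnerProductSpace ℝ g] [FiniteDimensional ℝ g] {L : LieStructure g} {Y : ℝ → g}
    (hY : L.IsSolution Y) (t : ℝ) : HasDerivAt (fun s => ‖Y s‖ ^ 2) 0 t := by
  simpa [L.inner_self_adT] using (hY t).norm_sq

open Metric in
/-- The energy-Casimir method: it suffices that the Lyapunov function detects `X`
on the sphere through `X`. -/
theorem LieStructure.isStable_of_lyapunov_on_sphere {g : Type*} [NormedAddCommGroup g]
    [InnerProductSpace ℝ g] [FiniteDimensional ℝ g] (L : LieStructure g) {X : g} {r : ℝ}
    (hr : 0 < r) {W : g → ℝ} (hW : Continuous W) (hWX : W X = 0) (hnonneg : ∀ Y, 0 ≤ W Y)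
    (huniq : ∀ Y ∈ closedBall X r, ‖Y‖ = ‖X‖ → W Y = 0 → Y = X)
    (hder : ∀ Y : ℝ → g, L.IsSolution Y → ∀ t, Y t ∈ closedBall X r →
      ∃ d ≤ 0, HasDerivAt (fun s => W (Y s)) d t) : L.IsStable X := by
  refine L.isStable_of_lyapunov hr (V := fun Y => W Y + (‖Y‖ ^ 2 - ‖X‖ ^ 2) ^ 2)
    (by fun_prop) (by simp [hWX]) (fun Y hY hne => ?_) (fun Y hY t ht => ?_)
  · refine lt_of_le_of_ne (add_nonneg (hnonneg Y) (sq_nonneg _)) fun h => hne ?_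
    have h1 : (‖Y‖ ^ 2 - ‖X‖ ^ 2) ^ 2 = 0 :=
      le_antisymm (by linarith [hnonneg Y]) (sq_nonneg _)
    refine huniq Y hY ?_ (by linarith)
    have h2 : ‖Y‖ ^ 2 = ‖X‖ ^ 2 := sub_eq_zero.1 (pow_eq_zero_iff two_ne_zero |>.1 h1)
    exact (pow_left_inj₀ (norm_nonneg _) (norm_nonneg _) two_ne_zero).1 h2
  · obtain ⟨d, hd, hWd⟩ := hder Y hY t ht
    refine ⟨d, hd, ?_⟩
    simpa using hWd.fun_add (((hY.hasDerivAt_norm_sq t).sub_const (‖X‖ ^ 2)).fun_pow 2)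

theorem OrthonormalBasis.eq_of_inner_eq_fin_three {g : Type*} [NormedAddCommGroup g]
    [InnerProductSpace ℝ g] (e : OrthonormalBasis (Fin 3) ℝ g) {X Y : g}
    (h0 : ⟪e 0, X⟫_ℝ = ⟪e 0, Y⟫_ℝ) (h1 : ⟪e 1, X⟫_ℝ = ⟪e 1, Y⟫_ℝ)
    (h2 : ⟪e 2, X⟫_ℝ = ⟪e 2, Y⟫_ℝ) : X = Y := by
  rw [← e.sum_repr' X, ← e.sum_repr' Y]
  simp [Fin.sum_univ_three, h0, h1, h2]

open Metric in
/-- If the non-unimodular flow contracts (weakly) transversally to the third axis, then that axis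
consists of stable points. -/
theorem LieStructure.exists_stable_of_det_nonneg {g : Type*} [NormedAddCommGroup g]
    [InnerProductSpace ℝ g] [FiniteDimensional ℝ g] (L : LieStructure g)
    (e : OrthonormalBasis (Fin 3) ℝ g) {a b c d : ℝ} (htr : a + d < 0)
    (hdet : 0 ≤ a * d - b * c)
    (h0 : ∀ Y, ⟪e 0, L.adT Y Y⟫_ℝ = ⟪e 2, Y⟫_ℝ * (a * ⟪e 0, Y⟫_ℝ + b * ⟪e 1, Y⟫_ℝ))
    (h1 : ∀ Y, ⟪e 1, L.adT Y Y⟫_ℝ = ⟪e 2, Y⟫_ℝ * (c * ⟪e 0, Y⟫_ℝ + d * ⟪e 1, Y⟫_ℝ))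
    (h2 : ∀ Y, ⟪e 2, L.adT Y Y⟫_ℝ = -(⟪e 0, Y⟫_ℝ * (a * ⟪e 0, Y⟫_ℝ + b * ⟪e 1, Y⟫_ℝ) +
      ⟪e 1, Y⟫_ℝ * (c * ⟪e 0, Y⟫_ℝ + d * ⟪e 1, Y⟫_ℝ))) :
    ∃ X : g, X ≠ 0 ∧ L.IsStationary X ∧ L.IsStable X := by
  have e02 : ⟪e 0, e 2⟫_ℝ = 0 := e.inner_eq_zero (by decide)
  have e12 : ⟪e 1, e 2⟫_ℝ = 0 := e.inner_eq_zero (by decide)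
  have e22 : ⟪e 2, e 2⟫_ℝ = 1 := e.inner_eq_one 2
  refine ⟨e 2, e.orthonormal.ne_zero 2, ?_, ?_⟩
  · refine e.eq_of_inner_eq_fin_three ?_ ?_ ?_ <;> simp [h0, h1, h2, e02, e12]
  have hz : ∀ Y ∈ closedBall (e 2) (1 / 2), 1 / 2 ≤ ⟪e 2, Y⟫_ℝ := fun Y hY => by
    have h := abs_real_inner_le_norm (e 2) (Y - e 2)
    rw [mem_closedBall, dist_eq_norm] at hY
    rw [inner_sub_right, e22, e.norm_eq_one, one_mul] at h
    linarith [(abs_le.1 h).1]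
  have key : ∀ x y : ℝ, ((a + d) ^ 2 + 2 * c ^ 2 - 2 * b * c) * x ^ 2 +
      2 * ((a - d) * (b - c)) * (x * y) + ((a + d) ^ 2 + 2 * b ^ 2 - 2 * b * c) * y ^ 2 =
      (a * x + b * y) ^ 2 + (c * x + d * y) ^ 2 + (d * x - b * y) ^ 2 + (a * y - c * x) ^ 2 +
        2 * ((a * d - b * c) * (x ^ 2 + y ^ 2)) := fun x y => by ring
  have hdn : ∀ x y : ℝ, 0 ≤ (a * d - b * c) * (x ^ 2 + y ^ 2) := fun x y => by positivity
  refine L.isStable_of_lyapunov_on_sphere (r := 1 / 2) (by norm_num) (W := fun Y =>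
    ((a + d) ^ 2 + 2 * c ^ 2 - 2 * b * c) * ⟪e 0, Y⟫_ℝ ^ 2 +
    2 * ((a - d) * (b - c)) * (⟪e 0, Y⟫_ℝ * ⟪e 1, Y⟫_ℝ) +
    ((a + d) ^ 2 + 2 * b ^ 2 - 2 * b * c) * ⟪e 1, Y⟫_ℝ ^ 2) (by fun_prop) (by simp [e02, e12])
    (fun Y => ?_) (fun Y hY hn hW => ?_) (fun Y hY t ht => ?_)
  · rw [key]
    have := hdn ⟪e 0, Y⟫_ℝ ⟪e 1, Y⟫_ℝ
    positivity
  · rw [key] at hW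
    have hs := e.sum_sq_norm_inner_right Y
    rw [hn, e.norm_eq_one, Fin.sum_univ_three] at hs
    simp only [Real.norm_eq_abs, sq_abs] at hs
    have hzY := hz Y hY
    obtain ⟨hx, hy⟩ : ⟪e 0, Y⟫_ℝ = 0 ∧ ⟪e 1, Y⟫_ℝ = 0 := by
      generalize ⟪e 0, Y⟫_ℝ = x, ⟪e 1, Y⟫_ℝ = y at hW
      have hxy := hdn x y
      have i1 : a * x + b * y = 0 := by nlinarith
      have i2 : c * x + d * y = 0 := by nlinarith
      have i3 : d * x - b * y = 0 := by nlinarith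
      have i4 : a * y - c * x = 0 := by nlinarith
      exact ⟨(mul_eq_zero_iff_left htr.ne).1 (by linear_combination i1 + i3),
        (mul_eq_zero_iff_left htr.ne).1 (by linear_combination i2 + i4)⟩
    refine e.eq_of_inner_eq_fin_three (hx.trans e02.symm) (hy.trans e12.symm) ?_
    rw [hx, hy] at hs
    rw [e22]
    nlinarith
  · have hx := hY.hasDerivAt_inner (e 0) t
    have hy := hY.hasDerivAt_inner (e 1) t
    rw [h0] at hx
    rw [h1] at hy
    have hzY := hz _ ht
    refine ⟨2 * ⟪e 2, Y t⟫_ℝ * (a + d) * ((a * ⟪e 0, Y t⟫_ℝ + b * ⟪e 1, Y t⟫_ℝ) ^ 2 +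
      (c * ⟪e 0, Y t⟫_ℝ + d * ⟪e 1, Y t⟫_ℝ) ^ 2 +
      (a * d - b * c) * (⟪e 0, Y t⟫_ℝ ^ 2 + ⟪e 1, Y t⟫_ℝ ^ 2)), ?_, ?_⟩
    · refine mul_nonpos_of_nonpos_of_nonneg
        (mul_nonpos_of_nonneg_of_nonpos (by linarith) htr.le) ?_
      have := hdn ⟪e 0, Y t⟫_ℝ ⟪e 1, Y t⟫_ℝ
      positivity
    · refine ((((hx.fun_pow 2).const_mul _).fun_add ((hx.fun_mul hy).const_mul _)).fun_add
        ((hy.fun_pow 2).const_mul _)).congr_deriv ?_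
      simp only [Nat.cast_ofNat, Nat.add_one_sub_one, pow_one]
      ring

/-- A left eigenvector of a real `2 × 2` matrix. -/
theorem exists_left_eigenvector_fin_two {a b c d l : ℝ} (hl : (a - l) * (d - l) - b * c = 0) :
    ∃ p q : ℝ, 0 < p ^ 2 + q ^ 2 ∧ p * a + q * c = l * p ∧ p * b + q * d = l * q := by
  obtain ⟨v, hv, hvM⟩ := (Matrix.exists_vecMul_eq_zero_iff (M := !![a - l, b; c, d - l])).2
    (by rw [Matrix.det_fin_two_of, hl])
  have h0 := congrFun hvM 0
  have h1 := congrFun hvM 1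
  simp [Matrix.vecMul, dotProduct, Fin.sum_univ_two] at h0 h1
  refine ⟨v 0, v 1, ?_, by linarith, by linarith⟩
  by_contra! h
  apply hv
  ext i
  fin_cases i
  · simp only [Fin.zero_eta, Pi.zero_apply]; nlinarith [sq_nonneg (v 0), sq_nonneg (v 1)]
  · simp only [Fin.mk_one, Pi.zero_apply]; nlinarith [sq_nonneg (v 0), sq_nonneg (v 1)]

/-- The critical point equations for `m log u + l log w` on a sphere of radius `m + l`, where
`u`, `w` are the inner products with two vectors of Gram matrix `!![A, B; B, C]`. -/
theorem exists_pos_gram_equations {l m A B C : ℝ} (hl : 0 < l) (hm : 0 < m) (hA : 0 < A)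
    (hB : 0 ≤ B) (hC : 0 < C) :
    ∃ u w : ℝ, 0 < u ∧ 0 < w ∧ m / u * A + l / w * B = u ∧ m / u * B + l / w * C = w := by
  set s := √(((l - m) * B) ^ 2 + 4 * (l * C) * (m * A))
  have hs : s ^ 2 = ((l - m) * B) ^ 2 + 4 * (l * C) * (m * A) := Real.sq_sqrt (by positivity)
  have hsB : |(l - m) * B| < s := by
    refine Real.lt_sqrt_of_sq_lt ?_
    rw [sq_abs]
    exact lt_add_of_pos_right _ (by positivity)
  set r := ((l - m) * B + s) / (2 * (l * C)) with hr
  have hr0 : 0 < r := div_pos (by linarith [(abs_lt.1 hsB).1]) (by positivity)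
  have hrq : l * C * r ^ 2 + (m - l) * B * r - m * A = 0 := by
    rw [hr]; field_simp; linear_combination hs
  have hu : 0 < √(m * A + l * B * r) := Real.sqrt_pos.2 (by positivity)
  have hu2 : √(m * A + l * B * r) ^ 2 = m * A + l * B * r := Real.sq_sqrt (by positivity)
  refine ⟨√(m * A + l * B * r), √(m * A + l * B * r) / r, hu, div_pos hu hr0, ?_, ?_⟩
  · field_simp
    linear_combination -hu2
  · field_simp
    linear_combination hrq - hu2

/-- Convexity estimate: the relative Lyapunov function built from the logarithms of two linear
forms dominates the squared distance to its critical point. -/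
theorem sq_norm_sub_le_of_log {g : Type*} [NormedAddCommGroup g]
    [InnerProductSpace ℝ g] {m l u w : ℝ} (hm : 0 < m) (hl : 0 < l) (hu : 0 < u) (hw : 0 < w)
    {f k : g} (hfu : ⟪f, (m / u) • f + (l / w) • k⟫_ℝ = u)
    (hkw : ⟪k, (m / u) • f + (l / w) • k⟫_ℝ = w) {Y : g} (hf : 0 < ⟪f, Y⟫_ℝ)
    (hk : 0 < ⟪k, Y⟫_ℝ) :
    ‖Y - ((m / u) • f + (l / w) • k)‖ ^ 2 ≤
      ‖Y‖ ^ 2 - ‖(m / u) • f + (l / w) • k‖ ^ 2 - 2 * (m * (Real.log ⟪f, Y⟫_ℝ - Real.log u) +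
        l * (Real.log ⟪k, Y⟫_ℝ - Real.log w)) := by
  set X := (m / u) • f + (l / w) • k with hX
  have hXY : ∀ Z, ⟪X, Z⟫_ℝ = m * (⟪f, Z⟫_ℝ / u) + l * (⟪k, Z⟫_ℝ / w) := fun Z => by
    rw [hX, inner_add_left, real_inner_smul_left, real_inner_smul_left]; ring
  have hXX : ‖X‖ ^ 2 = m + l := by
    rw [← real_inner_self_eq_norm_sq, hXY, hfu, hkw, div_self hu.ne', div_self hw.ne']; ring
  have h1 := Real.log_le_sub_one_of_pos (div_pos hf hu)
  have h2 := Real.log_le_sub_one_of_pos (div_pos hk hw)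
  rw [Real.log_div hf.ne' hu.ne'] at h1
  rw [Real.log_div hk.ne' hw.ne'] at h2
  rw [norm_sub_sq_real, real_inner_comm, hXY, hXX]
  nlinarith [mul_le_mul_of_nonneg_left h1 hm.le, mul_le_mul_of_nonneg_left h2 hl.le]

open Metric in
/-- A stability criterion for two vectors `f`, `k` whose pairings with solutions are
stretched and contracted at proportional rates, so that `m log ⟪f, Y⟫ + l log ⟪k, Y⟫` is
conserved. -/
theorem LieStructure.isStable_of_stretch_contract {g : Type*} [NormedAddCommGroup g]
    [InnerProductSpace ℝ g] [FiniteDimensional ℝ g] (L : LieStructure g)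
    {m l u w : ℝ} (hm : 0 < m) (hl : 0 < l) (hu : 0 < u) (hw : 0 < w) {f k n : g}
    (hfu : ⟪f, (m / u) • f + (l / w) • k⟫_ℝ = u)
    (hkw : ⟪k, (m / u) • f + (l / w) • k⟫_ℝ = w)
    (hf : ∀ Y, ⟪f, L.adT Y Y⟫_ℝ = l * (⟪n, Y⟫_ℝ * ⟪f, Y⟫_ℝ))
    (hk : ∀ Y, ⟪k, L.adT Y Y⟫_ℝ = -m * (⟪n, Y⟫_ℝ * ⟪k, Y⟫_ℝ)) :
    L.IsStable ((m / u) • f + (l / w) • k) := by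
  have hbound := fun Y => sq_norm_sub_le_of_log hm hl hu hw hfu hkw (Y := Y)
  set X := (m / u) • f + (l / w) • k
  have hnhds : ∀ᶠ Y in nhds X, 0 < ⟪f, Y⟫_ℝ ∧ 0 < ⟪k, Y⟫_ℝ := by
    refine Filter.Eventually.and ?_ ?_
    · exact (by fun_prop : Continuous fun Y => ⟪f, Y⟫_ℝ).continuousAt.eventually
        (lt_mem_nhds (hu.trans_eq hfu.symm))
    · exact (by fun_prop : Continuous fun Y => ⟪k, Y⟫_ℝ).continuousAt.eventually
        (lt_mem_nhds (hw.trans_eq hkw.symm))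
  obtain ⟨r, hr, hball⟩ := nhds_basis_closedBall.eventually_iff.1 hnhds
  refine L.isStable_of_lyapunov hr (V := fun Y => ‖Y‖ ^ 2 - ‖X‖ ^ 2 -
    2 * (m * (Real.log ⟪f, Y⟫_ℝ - Real.log u) + l * (Real.log ⟪k, Y⟫_ℝ - Real.log w)))
    ?_ (by simp [hfu, hkw]) (fun Y hY hne => ?_) (fun Y hY t ht => ⟨0, le_rfl, ?_⟩)
  · have h1 : ContinuousOn (fun Y => Real.log ⟪f, Y⟫_ℝ) (closedBall X r) :=
      ContinuousOn.log (by fun_prop) fun Y hY => (hball hY).1.ne'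
    have h2 : ContinuousOn (fun Y => Real.log ⟪k, Y⟫_ℝ) (closedBall X r) :=
      ContinuousOn.log (by fun_prop) fun Y hY => (hball hY).2.ne'
    fun_prop
  · refine lt_of_lt_of_le ?_ (hbound Y (hball hY).1 (hball hY).2)
    have := norm_pos_iff.2 (sub_ne_zero.2 hne)
    positivity
  · obtain ⟨hfY, hkY⟩ := hball ht
    refine (((hY.hasDerivAt_norm_sq t).sub_const (‖X‖ ^ 2)).fun_sub
      (((((hY.hasDerivAt_inner f t).log hfY.ne').sub_const (Real.log u)).const_mul m).fun_add
        ((((hY.hasDerivAt_inner k t).log hkY.ne').sub_const (Real.log w)).const_mul l)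
        |>.const_mul 2)).congr_deriv ?_
    rw [hf, hk]
    field_simp
    ring

/-- If the non-unimodular flow is hyperbolic transversally to the third axis, then there is a
stable point in the plane orthogonal to that axis. -/
theorem LieStructure.exists_stable_of_det_neg {g : Type*} [NormedAddCommGroup g]
    [InnerProductSpace ℝ g] [FiniteDimensional ℝ g] (L : LieStructure g)
    (e : OrthonormalBasis (Fin 3) ℝ g) {a b c d : ℝ} (hdet : a * d - b * c < 0)
    (h0 : ∀ Y, ⟪e 0, L.adT Y Y⟫_ℝ = ⟪e 2, Y⟫_ℝ * (a * ⟪e 0, Y⟫_ℝ + b * ⟪e 1, Y⟫_ℝ))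
    (h1 : ∀ Y, ⟪e 1, L.adT Y Y⟫_ℝ = ⟪e 2, Y⟫_ℝ * (c * ⟪e 0, Y⟫_ℝ + d * ⟪e 1, Y⟫_ℝ))
    (h2 : ∀ Y, ⟪e 2, L.adT Y Y⟫_ℝ = -(⟪e 0, Y⟫_ℝ * (a * ⟪e 0, Y⟫_ℝ + b * ⟪e 1, Y⟫_ℝ) +
      ⟪e 1, Y⟫_ℝ * (c * ⟪e 0, Y⟫_ℝ + d * ⟪e 1, Y⟫_ℝ))) :
    ∃ X : g, X ≠ 0 ∧ L.IsStationary X ∧ L.IsStable X := by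
  obtain ⟨l, m, hl, hm, hsum, hprod⟩ : ∃ l m : ℝ, 0 < l ∧ 0 < m ∧ l - m = a + d ∧
      l * m = -(a * d - b * c) := by
    set s := √((a + d) ^ 2 - 4 * (a * d - b * c))
    have hs : s ^ 2 = (a + d) ^ 2 - 4 * (a * d - b * c) :=
      Real.sq_sqrt (by nlinarith [sq_nonneg (a + d)])
    have habs : |a + d| < s := Real.lt_sqrt_of_sq_lt (by rw [sq_abs]; linarith)
    have := abs_lt.1 habs
    exact ⟨(s + (a + d)) / 2, (s - (a + d)) / 2, by linarith, by linarith, by ring,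
      by linear_combination hs / 4⟩
  obtain ⟨p, q, hpq, hp, hq⟩ := exists_left_eigenvector_fin_two (a := a) (b := b) (c := c)
    (d := d) (l := l) (by linear_combination l * hsum + hprod)
  obtain ⟨p', q', hpq', hp', hq', hg⟩ : ∃ p' q' : ℝ, 0 < p' ^ 2 + q' ^ 2 ∧
      p' * a + q' * c = -m * p' ∧ p' * b + q' * d = -m * q' ∧ 0 ≤ p * p' + q * q' := by
    obtain ⟨p', q', hpq', hp', hq'⟩ := exists_left_eigenvector_fin_two (a := a) (b := b) (c := c)
      (d := d) (l := -m) (by linear_combination -m * hsum + hprod)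
    rcases le_total 0 (p * p' + q * q') with h | h
    · exact ⟨p', q', hpq', hp', hq', h⟩
    · exact ⟨-p', -q', by simpa using hpq', by linarith, by linarith, by linarith⟩
  obtain ⟨u, w, hu, hw, hue, hwe⟩ := exists_pos_gram_equations hl hm hpq hg hpq'
  have e00 : ⟪e 0, e 0⟫_ℝ = 1 := e.inner_eq_one 0
  have e11 : ⟪e 1, e 1⟫_ℝ = 1 := e.inner_eq_one 1
  have e01 : ⟪e 0, e 1⟫_ℝ = 0 := e.inner_eq_zero (by decide)
  have e10 : ⟪e 1, e 0⟫_ℝ = 0 := e.inner_eq_zero (by decide)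
  have e20 : ⟪e 2, e 0⟫_ℝ = 0 := e.inner_eq_zero (by decide)
  have e21 : ⟪e 2, e 1⟫_ℝ = 0 := e.inner_eq_zero (by decide)
  set f := p • e 0 + q • e 1 with hf
  set k := p' • e 0 + q' • e 1 with hk
  have hfY : ∀ Y, ⟪f, Y⟫_ℝ = p * ⟪e 0, Y⟫_ℝ + q * ⟪e 1, Y⟫_ℝ := fun Y => by
    rw [hf, inner_add_left, real_inner_smul_left, real_inner_smul_left]
  have hkY : ∀ Y, ⟪k, Y⟫_ℝ = p' * ⟪e 0, Y⟫_ℝ + q' * ⟪e 1, Y⟫_ℝ := fun Y => by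
    rw [hk, inner_add_left, real_inner_smul_left, real_inner_smul_left]
  have hX : ∀ i, ⟪e i, (m / u) • f + (l / w) • k⟫_ℝ =
      (m / u * p + l / w * p') * ⟪e i, e 0⟫_ℝ + (m / u * q + l / w * q') * ⟪e i, e 1⟫_ℝ := by
    intro i
    simp only [hf, hk, inner_add_right, real_inner_smul_right]
    ring
  have hfu : ⟪f, (m / u) • f + (l / w) • k⟫_ℝ = u := by
    rw [hfY, hX, hX, e00, e01, e10, e11]; linear_combination hue
  have hkw : ⟪k, (m / u) • f + (l / w) • k⟫_ℝ = w := by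
    rw [hkY, hX, hX, e00, e01, e10, e11]; linear_combination hwe
  have hX2 : ⟪e 2, (m / u) • f + (l / w) • k⟫_ℝ = 0 := by rw [hX, e20, e21]; ring
  refine ⟨(m / u) • f + (l / w) • k, fun h => ?_, ?_, ?_⟩
  · rw [h, inner_zero_right] at hfu
    exact hu.ne hfu
  · refine e.eq_of_inner_eq_fin_three ?_ ?_ ?_
    · rw [h0, hX2]; simp
    · rw [h1, hX2]; simp
    · rw [h2, inner_zero_right]
      have hx := hX 0
      have hy := hX 1
      have hu' := hfY ((m / u) • f + (l / w) • k)
      have hw' := hkY ((m / u) • f + (l / w) • k)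
      rw [hfu] at hu'
      rw [hkw] at hw'
      rw [e00, e01, mul_one, mul_zero, add_zero] at hx
      rw [e10, e11, mul_one, mul_zero, zero_add] at hy
      have hmu : m / u * u = m := div_mul_cancel₀ m hu.ne'
      have hlw : l / w * w = l := div_mul_cancel₀ l hw.ne'
      generalize ⟪e 0, (m / u) • f + (l / w) • k⟫_ℝ = x at *
      generalize ⟪e 1, (m / u) • f + (l / w) • k⟫_ℝ = y at *
      linear_combination -(hx * (a * x + b * y) + hy * (c * x + d * y)) -
        m / u * (x * hp + y * hq) - l / w * (x * hp' + y * hq') + m / u * l * hu' -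
        l / w * m * hw' - l * hmu + m * hlw
  · refine L.isStable_of_stretch_contract (n := e 2) hm hl hu hw hfu hkw (fun Y => ?_) fun Y => ?_
    · rw [hfY, hfY, h0, h1]
      linear_combination ⟪e 2, Y⟫_ℝ * (⟪e 0, Y⟫_ℝ * hp + ⟪e 1, Y⟫_ℝ * hq)
    · rw [hkY, hkY, h0, h1]
      linear_combination ⟪e 2, Y⟫_ℝ * (⟪e 0, Y⟫_ℝ * hp' + ⟪e 1, Y⟫_ℝ * hq')

theorem LieStructure.bracket_swap_s1 {g : Type*} [NormedAddCommGroup g]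
    [InnerProductSpace ℝ g] (L : LieStructure g) (x y : g) : L.bracket x y = -L.bracket y x := by
  have h := L.bracket_self (x + y)
  simp only [map_add, LinearMap.add_apply, L.bracket_self, zero_add, add_zero] at h
  exact eq_neg_of_add_eq_zero_right h

theorem LieStructure.ad_bracket {g : Type*} [NormedAddCommGroup g]
    [InnerProductSpace ℝ g] (L : LieStructure g) (x y : g) :
    L.ad (L.bracket x y) = L.ad x ∘ₗ L.ad y - L.ad y ∘ₗ L.ad x := by
  ext z
  have h := L.jacobi x y z
  rw [L.bracket_swap_s1 z (L.bracket x y), L.bracket_swap_s1 z x, map_neg] at h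
  simp only [ad, LinearMap.sub_apply, LinearMap.comp_apply]
  rw [eq_comm, ← sub_eq_zero, ← h]
  abel

theorem LieStructure.trace_ad_bracket {g : Type*} [NormedAddCommGroup g]
    [InnerProductSpace ℝ g] [FiniteDimensional ℝ g] (L : LieStructure g) (x y : g) :
    LinearMap.trace ℝ g (L.ad (L.bracket x y)) = 0 := by
  rw [L.ad_bracket, map_sub, LinearMap.trace_comp_comm', sub_self]

/-- In an orthonormal basis, the Euler field is determined by the brackets of basis vectors. -/
theorem LieStructure.inner_basis_adT {g : Type*} [NormedAddCommGroup g]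
    [InnerProductSpace ℝ g] [FiniteDimensional ℝ g] (L : LieStructure g)
    (e : OrthonormalBasis (Fin 3) ℝ g) (i : Fin 3) (Y : g) :
    ⟪e i, L.adT Y Y⟫_ℝ = ∑ j, ∑ k, ⟪e j, Y⟫_ℝ * ⟪e k, Y⟫_ℝ * ⟪e k, L.bracket (e j) (e i)⟫_ℝ := by
  have h : L.bracket Y (e i) = ∑ j, ⟪e j, Y⟫_ℝ • L.bracket (e j) (e i) := by
    conv_lhs => rw [← e.sum_repr' Y]
    simp [map_sum, LinearMap.sum_apply]
  rw [L.inner_adT, h, sum_inner]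
  refine Finset.sum_congr rfl fun j _ => ?_
  rw [real_inner_smul_left, ← e.sum_inner_mul_inner (L.bracket (e j) (e i)), Finset.mul_sum]
  refine Finset.sum_congr rfl fun k _ => ?_
  rw [real_inner_comm (e k) (L.bracket (e j) (e i))]
  ring

theorem LieStructure.exists_stable_of_not_isUnimodular {g : Type*} [NormedAddCommGroup g]
    [InnerProductSpace ℝ g] [FiniteDimensional ℝ g] (L : LieStructure g)
    (hdim : Module.finrank ℝ g = 3) (hL : ¬ L.IsUnimodular) :
    ∃ X : g, X ≠ 0 ∧ L.IsStationary X ∧ L.IsStable X := by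
  obtain ⟨n, hn⟩ : ∃ n : g, ∀ Y, ⟪n, Y⟫_ℝ = -LinearMap.trace ℝ g (L.ad Y) := by
    refine ⟨(InnerProductSpace.toDual ℝ g).symm
      (-(LinearMap.trace ℝ g ∘ₗ L.bracket)).toContinuousLinearMap, fun Y => ?_⟩
    rw [InnerProductSpace.toDual_symm_apply]
    simp [ad]
  have hn0 : n ≠ 0 := by
    rintro rfl
    exact hL fun Y => by simpa using (hn Y).symm
  have hnorm : 0 < ‖n‖ := norm_pos_iff.2 hn0
  obtain ⟨e, he⟩ := Orthonormal.exists_orthonormalBasis_extension_of_card_eq (𝕜 := ℝ)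
    (ι := Fin 3) (by simp [hdim]) (v := fun _ => ‖n‖⁻¹ • n) (s := {2})
    ⟨fun _ => by simp [norm_smul, hnorm.ne'], fun i j hij => absurd (Subsingleton.elim i j) hij⟩
  have he2 : e 2 = ‖n‖⁻¹ • n := he 2 rfl
  have hne : n = ‖n‖ • e 2 := by rw [he2, smul_smul, mul_inv_cancel₀ hnorm.ne', one_smul]
  have htr : ∀ i, ⟪n, e i⟫_ℝ = -∑ j, ⟪e j, L.bracket (e i) (e j)⟫_ℝ := fun i => by
    rw [hn, LinearMap.trace_eq_sum_inner _ e]; rfl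
  have hb2 : ∀ x y, ⟪e 2, L.bracket x y⟫_ℝ = 0 := fun x y => by
    rw [he2, real_inner_smul_left, hn, L.trace_ad_bracket]; simp
  have hn2 : ⟪n, e 2⟫_ℝ = ‖n‖ := by
    conv_lhs => rw [hne]
    rw [real_inner_smul_left, e.inner_eq_one, mul_one]
  have hni : ∀ i ≠ 2, ⟪n, e i⟫_ℝ = 0 := fun i hi => by
    rw [hne, real_inner_smul_left, e.inner_eq_zero hi.symm, mul_zero]
  have t0 := htr 0
  have t1 := htr 1
  have t2 := htr 2
  rw [hni 0 (by decide), Fin.sum_univ_three, L.bracket_self, hb2, inner_zero_right] at t0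
  rw [hni 1 (by decide), Fin.sum_univ_three, L.bracket_self, hb2, inner_zero_right,
    L.bracket_swap_s1, inner_neg_right] at t1
  rw [hn2, Fin.sum_univ_three, hb2] at t2
  have h0 := L.inner_basis_adT e 0
  have h1 := L.inner_basis_adT e 1
  have h2 := L.inner_basis_adT e 2
  simp only [Fin.sum_univ_three, hb2, L.bracket_self, inner_zero_right, L.bracket_swap_s1 (e 1) (e 0),
    L.bracket_swap_s1 (e 0) (e 2), L.bracket_swap_s1 (e 1) (e 2), inner_neg_right] at h0 h1 h2
  have hadT0 : ∀ Y, ⟪e 0, L.adT Y Y⟫_ℝ = ⟪e 2, Y⟫_ℝ * (⟪e 0, L.bracket (e 2) (e 0)⟫_ℝ *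
      ⟪e 0, Y⟫_ℝ + ⟪e 1, L.bracket (e 2) (e 0)⟫_ℝ * ⟪e 1, Y⟫_ℝ) := fun Y => by
    rw [h0]
    linear_combination ⟪e 1, Y⟫_ℝ * ⟪e 0, Y⟫_ℝ * t1 - ⟪e 1, Y⟫_ℝ * ⟪e 1, Y⟫_ℝ * t0
  have hadT1 : ∀ Y, ⟪e 1, L.adT Y Y⟫_ℝ = ⟪e 2, Y⟫_ℝ * (⟪e 0, L.bracket (e 2) (e 1)⟫_ℝ *
      ⟪e 0, Y⟫_ℝ + ⟪e 1, L.bracket (e 2) (e 1)⟫_ℝ * ⟪e 1, Y⟫_ℝ) := fun Y => by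
    rw [h1]
    linear_combination ⟪e 0, Y⟫_ℝ * ⟪e 1, Y⟫_ℝ * t0 - ⟪e 0, Y⟫_ℝ * ⟪e 0, Y⟫_ℝ * t1
  have hadT2 : ∀ Y, ⟪e 2, L.adT Y Y⟫_ℝ = -(⟪e 0, Y⟫_ℝ * (⟪e 0, L.bracket (e 2) (e 0)⟫_ℝ *
      ⟪e 0, Y⟫_ℝ + ⟪e 1, L.bracket (e 2) (e 0)⟫_ℝ * ⟪e 1, Y⟫_ℝ) + ⟪e 1, Y⟫_ℝ *
      (⟪e 0, L.bracket (e 2) (e 1)⟫_ℝ * ⟪e 0, Y⟫_ℝ +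
        ⟪e 1, L.bracket (e 2) (e 1)⟫_ℝ * ⟪e 1, Y⟫_ℝ)) := fun Y => by
    rw [h2]; ring
  rcases lt_or_ge (⟪e 0, L.bracket (e 2) (e 0)⟫_ℝ * ⟪e 1, L.bracket (e 2) (e 1)⟫_ℝ -
    ⟪e 1, L.bracket (e 2) (e 0)⟫_ℝ * ⟪e 0, L.bracket (e 2) (e 1)⟫_ℝ) 0 with hdet | hdet
  · exact L.exists_stable_of_det_neg e hdet hadT0 hadT1 hadT2
  · exact L.exists_stable_of_det_nonneg e (by linarith) hdet hadT0 hadT1 hadT2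

/-- In the unimodular case the Euler field is `Y ↦ T Y × Y` for a self-adjoint operator `T`;
hence it vanishes on eigenvectors of `T` and preserves `⟪T Y, Y⟫`. -/
theorem LieStructure.IsUnimodular.exists_isSymmetric {g : Type*} [NormedAddCommGroup g]
    [InnerProductSpace ℝ g] [FiniteDimensional ℝ g] {L : LieStructure g}
    (hdim : Module.finrank ℝ g = 3) (hL : L.IsUnimodular) :
    ∃ T : g →ₗ[ℝ] g, T.IsSymmetric ∧ (∀ Y, ⟪T Y, L.adT Y Y⟫_ℝ = 0) ∧
      ∀ (c : ℝ) (Y : g), T Y = c • Y → L.IsStationary Y := by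
  let e : OrthonormalBasis (Fin 3) ℝ g := (stdOrthonormalBasis ℝ g).reindex (finCongr hdim)
  have htr : ∀ i, ∑ j, ⟪e j, L.bracket (e i) (e j)⟫_ℝ = 0 := fun i => by
    rw [← hL (e i), LinearMap.trace_eq_sum_inner _ e]; rfl
  have t0 := htr 0
  have t1 := htr 1
  have t2 := htr 2
  have h0 := L.inner_basis_adT e 0
  have h1 := L.inner_basis_adT e 1
  have h2 := L.inner_basis_adT e 2
  simp only [Fin.sum_univ_three, L.bracket_self, inner_zero_right, L.bracket_swap_s1 (e 1) (e 0),
    L.bracket_swap_s1 (e 0) (e 2), L.bracket_swap_s1 (e 2) (e 1), inner_neg_right]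
    at t0 t1 t2 h0 h1 h2
  set x := L.bracket (e 1) (e 2)
  set y := L.bracket (e 2) (e 0)
  set z := L.bracket (e 0) (e 1)
  have hs0 : ⟪e 1, z⟫_ℝ = ⟪e 2, y⟫_ℝ := by linarith
  have hs1 : ⟪e 2, x⟫_ℝ = ⟪e 0, z⟫_ℝ := by linarith
  have hs2 : ⟪e 0, y⟫_ℝ = ⟪e 1, x⟫_ℝ := by linarith
  let T : g →ₗ[ℝ] g := (innerₗ g (e 0)).smulRight x + (innerₗ g (e 1)).smulRight y +
    (innerₗ g (e 2)).smulRight z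
  have hT : ∀ Y, T Y = ⟪e 0, Y⟫_ℝ • x + ⟪e 1, Y⟫_ℝ • y + ⟪e 2, Y⟫_ℝ • z := fun Y => rfl
  have hTi : ∀ Y W, ⟪W, T Y⟫_ℝ = ⟪e 0, Y⟫_ℝ * ⟪W, x⟫_ℝ + ⟪e 1, Y⟫_ℝ * ⟪W, y⟫_ℝ +
      ⟪e 2, Y⟫_ℝ * ⟪W, z⟫_ℝ := fun Y W => by
    rw [hT, inner_add_right, inner_add_right]; simp only [real_inner_smul_right]
  have hexp : ∀ Y W, ⟪Y, W⟫_ℝ = ⟪e 0, Y⟫_ℝ * ⟪e 0, W⟫_ℝ + ⟪e 1, Y⟫_ℝ * ⟪e 1, W⟫_ℝ +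
      ⟪e 2, Y⟫_ℝ * ⟪e 2, W⟫_ℝ := fun Y W => by
    rw [← e.sum_inner_mul_inner, Fin.sum_univ_three]
    simp only [real_inner_comm]
  refine ⟨T, fun Y W => ?_, fun Y => ?_, fun c Y hY => ?_⟩
  · rw [hexp (T Y), hexp Y]
    simp only [hTi, hs0, hs1, hs2]
    ring
  · rw [hexp (T Y), h0, h1, h2]
    simp only [hTi, hs0, hs1, hs2]
    ring
  · have c0 := hTi Y (e 0)
    have c1 := hTi Y (e 1)
    have c2 := hTi Y (e 2)
    rw [hY, real_inner_smul_right] at c0 c1 c2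
    refine e.eq_of_inner_eq_fin_three ?_ ?_ ?_
    · rw [h0, inner_zero_right]
      simp only [hs0, hs1, hs2] at c1 c2 ⊢
      linear_combination ⟪e 1, Y⟫_ℝ * c2 - ⟪e 2, Y⟫_ℝ * c1
    · rw [h1, inner_zero_right]
      simp only [hs0, hs1, hs2] at c2 c0 ⊢
      linear_combination ⟪e 2, Y⟫_ℝ * c0 - ⟪e 0, Y⟫_ℝ * c2
    · rw [h2, inner_zero_right]
      simp only [hs0, hs1, hs2] at c0 c1 ⊢
      linear_combination ⟪e 0, Y⟫_ℝ * c1 - ⟪e 1, Y⟫_ℝ * c0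

theorem Antitone.const_or_exists_extremal_fin_three {f : Fin 3 → ℝ} (hf : Antitone f) :
    (∀ i, f i = f 0) ∨ ∃ i, ∃ s : ℝ, ∀ j ≠ i, 0 < s * (f i - f j) := by
  have h01 : f 1 ≤ f 0 := hf (by decide)
  have h12 : f 2 ≤ f 1 := hf (by decide)
  rcases h01.lt_or_eq with h | h
  · refine .inr ⟨0, 1, fun j hj => ?_⟩
    fin_cases j
    · exact absurd rfl hj
    · simpa using h
    · simpa using h12.trans_lt h
  rcases h12.lt_or_eq with h' | h'
  · refine .inr ⟨2, -1, fun j hj => ?_⟩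
    fin_cases j
    · simpa using h'.trans_le h01
    · simpa using h'
    · exact absurd rfl hj
  · refine .inl fun i => ?_
    fin_cases i
    · rfl
    · exact h
    · exact h'.trans h

theorem LieStructure.exists_stable_of_isUnimodular {g : Type*} [NormedAddCommGroup g]
    [InnerProductSpace ℝ g] [FiniteDimensional ℝ g] (L : LieStructure g)
    (hdim : Module.finrank ℝ g = 3) (hL : L.IsUnimodular) :
    ∃ X : g, X ≠ 0 ∧ L.IsStationary X ∧ L.IsStable X := by
  obtain ⟨T, hT, hcons, hstat⟩ := hL.exists_isSymmetric hdim
  set f := hT.eigenvectorBasis hdim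
  set ev := hT.eigenvalues hdim
  have hTf : ∀ i, T (f i) = ev i • f i := hT.apply_eigenvectorBasis hdim
  have hTfY : ∀ i Y, ⟪f i, T Y⟫_ℝ = ev i * ⟪f i, Y⟫_ℝ := fun i Y => by
    rw [← hT, hTf, real_inner_smul_left]
  rcases (hT.eigenvalues_antitone hdim).const_or_exists_extremal_fin_three with hconst | ⟨i, s, hs⟩
  · have hall : ∀ Y, L.adT Y Y = 0 := fun Y => hstat (ev 0) Y <| by
      rw [← f.sum_repr' (T Y)]
      conv_rhs => rw [← f.sum_repr' Y]
      simp only [hTfY, Finset.smul_sum, smul_smul, show ∀ i, ev i = ev 0 from hconst]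
    refine ⟨f 0, f.orthonormal.ne_zero 0, hall _, ?_⟩
    refine L.isStable_of_lyapunov one_pos (V := fun Y => ‖Y - f 0‖ ^ 2) (by fun_prop) (by simp)
      (fun Y _ hne => by have := norm_pos_iff.2 (sub_ne_zero.2 hne); positivity)
      fun Y hY t _ => ⟨0, le_rfl, ?_⟩
    have := hY t
    rw [hall] at this
    simpa using (this.sub_const (f 0)).norm_sq
  · have hW : ∀ Y, s * (ev i * ‖Y‖ ^ 2 - ⟪T Y, Y⟫_ℝ) =
        ∑ j, s * (ev i - ev j) * ⟪f j, Y⟫_ℝ ^ 2 := fun Y => by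
      rw [← f.sum_sq_norm_inner_right Y, ← f.sum_inner_mul_inner, Finset.mul_sum,
        ← Finset.sum_sub_distrib, Finset.mul_sum]
      refine Finset.sum_congr rfl fun j _ => ?_
      rw [real_inner_comm (f j) (T Y), hTfY, Real.norm_eq_abs, sq_abs]
      ring
    have hterm : ∀ Y j, 0 ≤ s * (ev i - ev j) * ⟪f j, Y⟫_ℝ ^ 2 := fun Y j => by
      rcases eq_or_ne j i with rfl | h
      · simp
      · have := hs j h
        positivity
    refine ⟨f i, f.orthonormal.ne_zero i, hstat _ _ (hTf i), ?_⟩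
    have hTc : Continuous T := T.continuous_of_finiteDimensional
    refine L.isStable_of_lyapunov_on_sphere one_pos
      (W := fun Y => s * (ev i * ‖Y‖ ^ 2 - ⟪T Y, Y⟫_ℝ)) (by fun_prop) ?_ (fun Y => ?_)
      (fun Y hY hn h => ?_) (fun Y hY t _ => ⟨0, le_rfl, ?_⟩)
    · rw [hTf, real_inner_smul_left, real_inner_self_eq_norm_sq, sub_self, mul_zero]
    · rw [hW]
      exact Finset.sum_nonneg fun j _ => hterm Y j
    · rw [hW, Finset.sum_eq_zero_iff_of_nonneg fun j _ => hterm Y j] at h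
      have hz : ∀ j ≠ i, ⟪f j, Y⟫_ℝ = 0 := fun j hj =>
        pow_eq_zero_iff two_ne_zero |>.1
          ((mul_eq_zero.1 (h j (Finset.mem_univ j))).resolve_left (hs j hj).ne')
      have hYi : Y = ⟪f i, Y⟫_ℝ • f i := by
        conv_lhs => rw [← f.sum_repr' Y]
        exact Finset.sum_eq_single i (fun j _ hj => by rw [hz j hj, zero_smul]) (by simp)
      rw [hYi, norm_smul, f.norm_eq_one, mul_one, Real.norm_eq_abs] at hn
      rw [Metric.mem_closedBall, dist_eq_norm] at hY
      rcases eq_or_eq_neg_of_abs_eq hn with h1 | h1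
      · rw [hYi, h1, one_smul]
      · rw [hYi, h1, neg_one_smul, ← neg_add', norm_neg, ← two_smul ℝ, norm_smul,
          f.norm_eq_one] at hY
        norm_num at hY
    · have h1 : HasDerivAt (fun s => T (Y s)) (T (L.adT (Y t) (Y t))) t :=
        T.toContinuousLinearMap.hasFDerivAt.comp_hasDerivAt t (hY t)
      refine ((((hY.hasDerivAt_norm_sq t).const_mul (ev i)).fun_sub
        (h1.inner ℝ (hY t))).const_mul s).congr_deriv ?_
      rw [hcons, hT, real_inner_comm, hcons]
      simp

/-- A 3-dimensional metric Lie algebra always has a nonzero stable stationary point. -/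
theorem exists_stable_stationary_dim3    {g : Type*} [NormedAddCommGroup g] [InnerProductSpace ℝ g] [FiniteDimensional ℝ g]
    (L : LieStructure g) (hdim : Module.finrank ℝ g = 3) :
    ∃ X : g, X ≠ 0 ∧ L.IsStationary X ∧ L.IsStable X := by
  by_cases hL : L.IsUnimodular
  · exact L.exists_stable_of_isUnimodular hdim hL
  · exact L.exists_stable_of_not_isUnimodular hdim hL
end

section
/- Let (g,⟨·,·⟩) be a unimodular metric Lie algebra with dim g = 4 whose centre z satisfies dim z > 1, and let X ∈ g be a stationary point of the Euler equation. Then X is stable if and only if X ∈ z. -/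
open scoped InnerProductSpace

/-- In a plane `S`, a vector `p` can be rotated by a right angle, and together with its rotation
it spans `S`. -/
lemma Submodule.exists_right_angle_rotation {E : Type*} [NormedAddCommGroup E]
    [InnerProductSpace ℝ E] [FiniteDimensional ℝ E] (S : Submodule ℝ E)
    (hS : Module.finrank ℝ S = 2) {p : E} (hp : p ∈ S) :
    ∃ q ∈ S, ⟪p, q⟫_ℝ = 0 ∧ ⟪q, q⟫_ℝ = ⟪p, p⟫_ℝ ∧
      ∀ Z ∈ S, ⟪p, p⟫_ℝ • Z = ⟪p, Z⟫_ℝ • p + ⟪q, Z⟫_ℝ • q := by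
  let b := (stdOrthonormalBasis ℝ S).reindex (finCongr hS)
  have h00 : ⟪(b 0 : E), b 0⟫_ℝ = 1 := b.inner_eq_one 0
  have h11 : ⟪(b 1 : E), b 1⟫_ℝ = 1 := b.inner_eq_one 1
  have h01 : ⟪(b 0 : E), b 1⟫_ℝ = 0 := b.inner_eq_zero (by decide)
  have h10 : ⟪(b 1 : E), b 0⟫_ℝ = 0 := b.inner_eq_zero (by decide)
  have hrep : ∀ Z ∈ S, ∃ x y : ℝ, Z = x • (b 0 : E) + y • (b 1 : E) := fun Z hZ ↦
    ⟨_, _, by simpa [Fin.sum_univ_two] using congrArg (Subtype.val) (b.sum_repr ⟨Z, hZ⟩).symm⟩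
  obtain ⟨x, y, rfl⟩ := hrep p hp
  refine ⟨-y • (b 0 : E) + x • (b 1 : E),
    S.add_mem (S.smul_mem _ (b 0).2) (S.smul_mem _ (b 1).2), ?_, ?_, fun Z hZ ↦ ?_⟩
  · simp only [inner_add_left, inner_add_right, real_inner_smul_left, real_inner_smul_right,
      h00, h01, h10, h11]
    ring
  · simp only [inner_add_left, inner_add_right, real_inner_smul_left, real_inner_smul_right,
      h00, h01, h10, h11]
    ring
  · obtain ⟨c, d, rfl⟩ := hrep Z hZ
    simp only [inner_add_left, inner_add_right, real_inner_smul_left, real_inner_smul_right,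
      h00, h01, h10, h11]
    module

namespace LieStructure

variable {g : Type*} [NormedAddCommGroup g] [InnerProductSpace ℝ g] (L : LieStructure g)

lemma bracket_skew (x y : g) : L.bracket y x = -L.bracket x y := by
  have h := L.bracket_self (x + y)
  simp only [map_add, LinearMap.add_apply, L.bracket_self, zero_add, add_zero] at h
  exact eq_neg_of_add_eq_zero_left h

lemma bracket_center_left {x : g} (hx : x ∈ L.center) (y : g) : L.bracket x y = 0 := by
  rw [LinearMap.mem_ker.mp hx, LinearMap.zero_apply]

lemma bracket_center_right {x : g} (hx : x ∈ L.center) (y : g) : L.bracket y x = 0 := by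
  rw [L.bracket_skew x, L.bracket_center_left hx, neg_zero]

variable [FiniteDimensional ℝ g]

lemma inner_adT_self (Y Z : g) : ⟪L.adT Y Y, Z⟫_ℝ = ⟪Y, L.bracket Y Z⟫_ℝ :=
  LinearMap.adjoint_inner_left _ _ _

/-- Along solutions of the Euler equation the distance to a central element is constant. -/
lemma IsSolution.inner_sub_center_eq {Y : ℝ → g} (hY : L.IsSolution Y) {X : g}
    (hX : X ∈ L.center) (t : ℝ) : ⟪Y t - X, Y t - X⟫_ℝ = ⟪Y 0 - X, Y 0 - X⟫_ℝ := by
  have hd : ∀ s, HasDerivAt (fun s ↦ ⟪Y s - X, Y s - X⟫_ℝ) 0 s := fun s ↦ by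
    have h := ((hY s).sub_const X).inner ℝ ((hY s).sub_const X)
    have h0 : ⟪L.adT (Y s) (Y s), Y s - X⟫_ℝ = 0 := by
      rw [inner_adT_self, map_sub, L.bracket_self, L.bracket_center_right hX, sub_zero,
        inner_zero_right]
    rwa [real_inner_comm, h0, add_zero] at h
  exact is_const_of_deriv_eq_zero (fun s ↦ (hd s).differentiableAt) (fun s ↦ (hd s).deriv) t 0

/-- Central elements are stable. -/
lemma isStable_of_mem_center {X : g} (hX : X ∈ L.center) : L.IsStable X := by
  refine fun ε hε ↦ ⟨ε, hε, fun Y hY h0 t _ ↦ ?_⟩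
  have h := hY.inner_sub_center_eq L hX t
  rw [real_inner_self_eq_norm_sq, real_inner_self_eq_norm_sq] at h
  rwa [(sq_eq_sq₀ (norm_nonneg _) (norm_nonneg _)).mp h]

/-- The centre does not have codimension one. -/
lemma finrank_center_orthogonal_ne_one : Module.finrank ℝ L.centerᗮ ≠ 1 := by
  intro h1
  obtain ⟨⟨p, hp⟩, hp0, hspan⟩ := finrank_eq_one_iff'.mp h1
  have hpc : p ∈ L.center := by
    refine LinearMap.mem_ker.mpr (LinearMap.ext fun Z ↦ ?_)
    obtain ⟨y, hy, z, hz, rfl⟩ := L.center.exists_add_mem_mem_orthogonal Z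
    obtain ⟨c, hc⟩ := hspan ⟨z, hz⟩
    obtain rfl : c • p = z := congrArg Subtype.val hc
    simp [L.bracket_center_right hy, L.bracket_self]
  exact hp0 (Subtype.ext (inner_self_eq_zero.mp (hp p hpc)))

/-- In a Heisenberg-type algebra with centre of codimension two, the non-central stationary points
are unstable: perturbing along the derived algebra produces a rotation about the centre. -/
lemma not_isStable_of_finrank_center_orthogonal (huni : L.IsUnimodular)
    (hcodim : Module.finrank ℝ L.centerᗮ = 2) {X : g} (hX : L.IsStationary X)
    (hXc : X ∉ L.center) : ¬ L.IsStable X := by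
  obtain ⟨ζ, hζ, p, hp, rfl⟩ := L.center.exists_add_mem_mem_orthogonal X
  have hp0 : p ≠ 0 := by
    rintro rfl
    exact hXc (by simpa using hζ)
  obtain ⟨q, hq, hpq, hqq, hspan⟩ := L.centerᗮ.exists_right_angle_rotation hcodim hp
  set r : ℝ := ⟪p, p⟫_ℝ with hr
  have hr0 : 0 < r := real_inner_self_pos.mpr hp0
  have hqp : ⟪q, p⟫_ℝ = 0 := by rw [real_inner_comm, hpq]
  have hdecomp : ∀ Z : g, ∃ y ∈ L.center,
      Z = y + (⟪p, Z⟫_ℝ / r) • p + (⟪q, Z⟫_ℝ / r) • q := fun Z ↦ by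
    obtain ⟨y, hy, z, hz, rfl⟩ := L.center.exists_add_mem_mem_orthogonal Z
    refine ⟨y, hy, ?_⟩
    have h := congrArg (r⁻¹ • ·) (hspan z hz)
    simp only [smul_smul, inv_mul_cancel₀ hr0.ne', one_smul, smul_add] at h
    rw [inner_add_right, inner_add_right, Submodule.inner_left_of_mem_orthogonal hy hp,
      Submodule.inner_left_of_mem_orthogonal hy hq, zero_add, zero_add, add_assoc, div_eq_inv_mul,
      div_eq_inv_mul, ← h]
  set w : g := L.bracket p q with hw
  have hqpw : L.bracket q p = -w := L.bracket_skew p q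
  have hadp : ∀ Z, L.bracket p Z = (⟪q, Z⟫_ℝ / r) • w := fun Z ↦ by
    obtain ⟨y, hy, hZ⟩ := hdecomp Z
    conv_lhs => rw [hZ]
    simp [L.bracket_center_right hy, L.bracket_self, ← hw]
  have hadq : ∀ Z, L.bracket q Z = -(⟪p, Z⟫_ℝ / r) • w := fun Z ↦ by
    obtain ⟨y, hy, hZ⟩ := hdecomp Z
    conv_lhs => rw [hZ]
    simp [L.bracket_center_right hy, L.bracket_self, hqpw]
  have hqw : ⟪q, w⟫_ℝ = 0 := by
    have h := huni p
    have he : L.ad p = LinearMap.smulRight (r⁻¹ • (innerₛₗ ℝ q)) w := by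
      ext Z
      simp [ad, hadp, div_eq_inv_mul]
    rw [he, LinearMap.trace_smulRight] at h
    simpa [hr0.ne'] using h
  have hpw : ⟪p, w⟫_ℝ = 0 := by
    have h := huni q
    have he : L.ad q = LinearMap.smulRight (-r⁻¹ • (innerₛₗ ℝ p)) w := by
      ext Z
      simp [ad, hadq, div_eq_inv_mul]
    rw [he, LinearMap.trace_smulRight] at h
    simpa [hr0.ne'] using h
  have hwc : w ∈ L.center := by
    obtain ⟨y, hy, h⟩ := hdecomp w
    rw [hpw, hqw] at h
    simp only [zero_div, zero_smul, add_zero] at h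
    rwa [h]
  have hw0 : w ≠ 0 := fun h0 ↦ by
    have hpc : p ∈ L.center := LinearMap.mem_ker.mpr (LinearMap.ext fun Z ↦ by simp [hadp, h0])
    exact hp0 (inner_self_eq_zero.mp (hp p hpc))
  have hζw : ⟪ζ, w⟫_ℝ = 0 := by
    have h := L.inner_adT_self (ζ + p) q
    rw [hX, inner_zero_left, map_add, LinearMap.add_apply, L.bracket_center_left hζ, zero_add,
      ← hw, inner_add_left, hpw, add_zero] at h
    exact h.symm
  intro hstab
  obtain ⟨δ, hδ, hst⟩ := hstab ‖p‖ (norm_pos_iff.mpr hp0)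
  have hwn : 0 < ‖w‖ := norm_pos_iff.mpr hw0
  have hww : 0 < ⟪w, w⟫_ℝ := real_inner_self_pos.mpr hw0
  set d : ℝ := δ / 2 / ‖w‖ with hd
  have hd0 : 0 < d := by positivity
  set θ : ℝ := d * ⟪w, w⟫_ℝ / r with hθ
  have hθ0 : 0 < θ := by positivity
  let Y : ℝ → g := fun t ↦ ζ + d • w + (Real.cos (θ * t) • p + Real.sin (θ * t) • q)
  have hsol : L.IsSolution Y := fun t ↦ by
    have hlin : HasDerivAt (fun s : ℝ ↦ θ * s) θ t := by
      simpa using (hasDerivAt_id t).const_mul θ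
    have hder := ((hlin.cos.smul_const p).add (hlin.sin.smul_const q)).const_add (ζ + d • w)
    refine hder.congr_deriv (ext_inner_right ℝ fun Z ↦ ?_)
    rw [inner_adT_self]
    simp only [Y, map_add, map_smul, LinearMap.add_apply, LinearMap.smul_apply,
      L.bracket_center_left hζ, L.bracket_center_left hwc, hadp, hadq, inner_add_left,
      inner_add_right, real_inner_smul_left, real_inner_smul_right, hζw, hpw, hqw,
      inner_zero_right, hθ]
    ring
  have hY0 : ‖Y 0 - (ζ + p)‖ < δ := by
    have : Y 0 - (ζ + p) = d • w := by simp [Y]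
    rw [this, norm_smul, Real.norm_of_nonneg hd0.le, hd, div_mul_cancel₀ _ hwn.ne']
    linarith
  have hlt := hst Y hsol hY0 (Real.pi / θ) (div_nonneg Real.pi_pos.le hθ0.le)
  have hYπ : Y (Real.pi / θ) - (ζ + p) = d • w - (2 : ℝ) • p := by
    simp only [Y, mul_div_cancel₀ _ hθ0.ne', Real.cos_pi, Real.sin_pi]
    module
  have hin : ⟪p, (2 : ℝ) • p - d • w⟫_ℝ = 2 * ‖p‖ ^ 2 := by
    rw [inner_sub_right, real_inner_smul_right, real_inner_smul_right, hpw,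
      real_inner_self_eq_norm_sq]
    ring
  have hcs := real_inner_le_norm p ((2 : ℝ) • p - d • w)
  rw [hYπ, norm_sub_rev] at hlt
  rw [hin] at hcs
  nlinarith [norm_pos_iff.mpr hp0]

end LieStructure

/-- Theorem 1.2 (A)(a): in a 4-dimensional unimodular metric Lie algebra with centre of
dimension `> 1`, a stationary point is stable iff it lies in the centre. -/
theorem stability_iff_mem_center_dim4    {g : Type*} [NormedAddCommGroup g] [InnerProductSpace ℝ g] [FiniteDimensional ℝ g]
    (L : LieStructure g) (hdim : Module.finrank ℝ g = 4)
    (huni : L.IsUnimodular) (hz : 1 < Module.finrank ℝ ↥L.center)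
    (X : g) (hX : L.IsStationary X) :
    L.IsStable X ↔ X ∈ L.center := by
  refine ⟨fun hstab ↦ ?_, L.isStable_of_mem_center⟩
  by_contra hXc
  have hsum := L.center.finrank_add_finrank_orthogonal
  have hne := L.finrank_center_orthogonal_ne_one
  have hne0 : Module.finrank ℝ L.centerᗮ ≠ 0 := fun h0 ↦ by
    rw [Submodule.finrank_eq_zero, Submodule.orthogonal_eq_bot_iff] at h0
    exact hXc (h0 ▸ Submodule.mem_top)
  exact L.not_isStable_of_finrank_center_orthogonal huni (by omega) hX hXc hstab
end
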